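/- arXiv:1511.05522 — 3 statements merged into one kernel-verified Lean document; each statement's English description precedes it below -/
import Mathlib

section
/- The third group cohomology of the Klein four-group with coefficients in ℂˣ (with trivial action) is elementary abelian of order 8: H³(ℤ/2ℤ × ℤ/2ℤ, ℂˣ) ≅ (ℤ/2ℤ)³ as abelian groups. -/
namespace KleinH3

/-- A formal integral combination of basis elements (coded by natural numbers): the pair of the
list of terms with sign `+` and the list of terms with sign `-`. -/
abbrev KChain := List ℕ × List ℕ

/-- Sum of formal combinations. -/
def cadd (c d : KChain) : KChain := (c.1 ++ d.1, c.2 ++ d.2)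

/-- Difference of formal combinations. -/
def csub (c d : KChain) : KChain := (c.1 ++ d.2, c.2 ++ d.1)

/-- The code of a triple. -/
def code3 (x y z : ℕ) : ℕ := 16 * x + 4 * y + z

/-- Boundary of a four-fold basis element of the bar complex: positive terms. -/
def faceP (n : ℕ) : List ℕ :=
  let a := n / 64 % 4
  let b := n / 16 % 4
  let c := n / 4 % 4
  let d := n % 4
  [code3 b c d, code3 a (b ^^^ c) d, code3 a b c]

/-- Boundary of a four-fold basis element of the bar complex: negative terms. -/
def faceN (n : ℕ) : List ℕ :=
  let a := n / 64 % 4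
  let b := n / 16 % 4
  let c := n / 4 % 4
  let d := n % 4
  [code3 (a ^^^ b) c d, code3 a b (c ^^^ d)]

/-- Boundary of a four-chain. -/
def bdry (c : KChain) : KChain :=
  (c.1.flatMap faceP ++ c.2.flatMap faceN, c.1.flatMap faceN ++ c.2.flatMap faceP)

/-- Chain homotopy on two-chains of the bar complex, listed by the code of the basis element. -/
def hTwo : List KChain := [
   ([], []), ([1], [0]), ([2], [0]), ([3], [0]), ([4], [16]), ([0, 4], [1, 16]), ([3, 4], [1,
   16]), ([2, 4, 7, 9, 18, 25, 32, 36], [1, 6, 8, 16, 19, 24, 33, 37]), ([8], [32]), ([3, 8], [2,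
   32]), ([0, 8], [2, 32]), ([0, 8, 11, 34, 41], [2, 10, 32, 35, 40]), ([12], [48]), ([2, 9, 13,
   32, 36], [3, 8, 33, 37, 48]), ([0, 9, 14, 34, 36, 41], [3, 10, 33, 38, 40, 48]), ([0, 0, 4, 9,
   15, 34, 36, 41, 50, 57], [1, 3, 5, 10, 33, 38, 40, 48, 51, 56])]

/-- Chain homotopy on three-chains of the bar complex, listed by the code of the basis element. -/
def hThree : List KChain := [
   ([0], []), ([0], []), ([0], []), ([0], []), ([4], []), ([1, 5], [0]), ([1, 6], [3]), ([1, 7],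
   [2]), ([8], []), ([2, 9], [3]), ([2, 10], [0]), ([2, 11], [1]), ([12], []), ([3, 13], [2]),
   ([3, 14], [1]), ([3, 15], [0]), ([4], []), ([4, 17, 64], [16, 65]), ([4, 18, 64], [16, 66]),
   ([4, 19, 64], [16, 67]), ([20, 80], [68]), ([1, 5, 16, 20, 65, 80], [0, 4, 17, 64, 68]), ([2,
   5, 19, 20, 65, 80], [0, 7, 17, 67, 68]), ([2, 5, 9, 18, 20, 23, 25, 32, 36, 65, 70, 72, 80, 83,
   88, 97, 101, 129, 133, 144, 148], [0, 6, 8, 17, 22, 24, 33, 37, 66, 68, 71, 73, 82, 89, 96,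
   100, 128, 132, 145, 149]), ([12, 24, 96], [48, 72]), ([6, 13, 19, 24, 66, 96], [7, 18, 48, 67,
   72]), ([6, 14, 16, 24, 66, 96], [4, 18, 48, 64, 72]), ([6, 15, 16, 24, 27, 50, 57, 66, 74, 96,
   99, 104], [5, 18, 26, 48, 51, 56, 64, 72, 75, 98, 105]), ([8, 28, 112], [32, 76]), ([7, 9, 18,
   25, 29, 36, 67, 72, 97, 101, 112, 129, 133, 144, 148], [6, 19, 24, 33, 37, 66, 73, 77, 96, 100,
   128, 132, 145, 149]), ([1, 7, 10, 16, 25, 30, 38, 40, 67, 74, 97, 102, 104, 112, 130, 133, 137,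
   146, 148, 153, 160, 164], [0, 4, 19, 26, 34, 37, 41, 64, 73, 78, 98, 100, 105, 128, 134, 136,
   145, 150, 152, 161, 165]), ([1, 5, 7, 11, 16, 16, 20, 25, 31, 38, 65, 67, 69, 74, 97, 102, 104,
   112, 115, 120, 130, 133, 137, 146, 148, 153, 160, 164], [0, 4, 4, 17, 19, 21, 26, 35, 37, 64,
   64, 68, 73, 79, 98, 100, 105, 114, 121, 128, 134, 136, 145, 150, 152, 161, 165]), ([8], []),
   ([8, 33, 128], [32, 129]), ([8, 34, 128], [32, 130]), ([8, 35, 128], [32, 131]), ([12, 36,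
   144], [48, 132]), ([9, 13, 32, 36, 129, 144], [8, 33, 48, 128, 132]), ([9, 14, 35, 36, 129,
   144], [11, 33, 48, 131, 132]), ([0, 4, 9, 15, 34, 36, 39, 41, 50, 57, 129, 134, 136, 144, 147,
   152, 161, 165], [1, 5, 10, 33, 38, 40, 48, 51, 56, 130, 132, 135, 137, 146, 153, 160, 164]),
   ([40, 160], [136]), ([1, 10, 35, 40, 130, 160], [0, 11, 34, 131, 136]), ([2, 10, 32, 40, 130,
   160], [0, 8, 34, 128, 136]), ([2, 10, 32, 40, 43, 130, 138, 160, 163, 168], [0, 8, 34, 42, 128,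
   136, 139, 162, 169]), ([4, 44, 176], [16, 140]), ([0, 4, 11, 34, 41, 45, 131, 136, 161, 165,
   176], [1, 10, 16, 35, 40, 130, 137, 141, 160, 164]), ([2, 4, 11, 32, 41, 46, 131, 138, 161,
   166, 168, 176], [1, 8, 16, 35, 42, 128, 137, 142, 162, 164, 169]), ([2, 4, 7, 9, 11, 18, 25,
   32, 32, 36, 41, 47, 129, 131, 133, 138, 161, 166, 168, 176, 179, 184], [1, 6, 8, 8, 16, 19, 24,
   33, 35, 37, 42, 128, 128, 132, 137, 143, 162, 164, 169, 178, 185]), ([12], []), ([12, 49, 192],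
   [48, 193]), ([12, 50, 192], [48, 194]), ([12, 51, 192], [48, 195]), ([8, 52, 208], [32, 196]),
   ([9, 13, 36, 53, 129, 133, 144, 148, 193, 208], [12, 33, 37, 128, 132, 145, 149, 192, 196]),
   ([1, 5, 10, 13, 38, 40, 51, 54, 56, 130, 133, 137, 146, 148, 153, 160, 164, 193, 208], [0, 4,
   15, 34, 37, 41, 50, 57, 128, 134, 136, 145, 150, 152, 161, 165, 195, 196]), ([1, 5, 11, 13, 16,
   20, 38, 55, 130, 133, 137, 146, 148, 153, 160, 164, 193, 198, 200, 208, 211, 216, 225, 229],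
   [0, 4, 14, 17, 21, 35, 37, 128, 134, 136, 145, 150, 152, 161, 165, 194, 196, 199, 201, 210,
   217, 224, 228]), ([4, 56, 224], [16, 200]), ([5, 14, 51, 56, 194, 224], [15, 16, 50, 195,
   200]), ([2, 4, 9, 14, 32, 36, 41, 58, 129, 134, 138, 144, 152, 161, 166, 168, 194, 224], [1, 8,
   12, 16, 33, 38, 42, 128, 132, 137, 146, 154, 162, 164, 169, 192, 200]), ([2, 4, 7, 9, 14, 18,
   25, 32, 36, 41, 59, 129, 134, 138, 144, 152, 161, 166, 168, 194, 202, 224, 227, 232], [1, 6, 8,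
   13, 16, 19, 24, 33, 38, 42, 128, 132, 137, 146, 154, 162, 164, 169, 192, 200, 203, 226, 233]),
   ([60, 240], [204]), ([1, 15, 16, 20, 50, 57, 61, 195, 200, 225, 229, 240], [0, 14, 17, 21, 51,
   56, 194, 201, 205, 224, 228]), ([2, 2, 4, 9, 15, 18, 20, 25, 32, 36, 41, 50, 57, 62, 129, 134,
   138, 144, 152, 161, 166, 168, 195, 202, 225, 230, 232, 240], [0, 1, 6, 8, 13, 17, 22, 24, 33,
   38, 42, 51, 56, 128, 132, 137, 146, 154, 162, 164, 169, 192, 201, 206, 226, 228, 233]), ([2, 2,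
   4, 9, 9, 15, 18, 20, 25, 32, 32, 36, 36, 41, 50, 57, 63, 129, 129, 133, 134, 138, 144, 144,
   148, 152, 161, 166, 168, 193, 195, 197, 202, 225, 230, 232, 240, 243, 248], [0, 1, 6, 8, 8, 12,
   17, 22, 24, 33, 33, 37, 38, 42, 51, 56, 128, 128, 132, 132, 137, 145, 146, 149, 154, 162, 164,
   169, 192, 192, 196, 201, 207, 226, 228, 233, 242, 249])]

/-- Image of the generator `e_30` of the small resolution in the bar complex. -/
def gA : KChain :=
   ([0, 4, 17, 21], [1, 5, 16, 20])

/-- Image of the generator `e_21` of the small resolution in the bar complex. -/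
def gB : KChain :=
   ([0, 6, 8, 17, 22, 24, 33, 37], [2, 5, 9, 18, 20, 25, 32, 36])

/-- Image of the generator `e_12` of the small resolution in the bar complex. -/
def gC : KChain :=
   ([0, 4, 9, 18, 26, 34, 36, 41], [1, 6, 10, 16, 24, 33, 38, 40])

/-- Image of the generator `e_03` of the small resolution in the bar complex. -/
def gD : KChain :=
   ([0, 8, 34, 42], [2, 10, 32, 40])

/-- Equality test for formal combinations. -/
def ceqv (c d : KChain) : Bool := (c.1 ++ d.2).isPerm (d.1 ++ c.2)

/-- The homotopy on a two-fold basis element. -/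
def q2 (x y : ℕ) : KChain := hTwo.getD (4 * x + y) ([], [])

/-- The first bit of a number. -/
def bit0' (x : ℕ) : ℕ := x % 2

/-- The second bit of a number. -/
def bit1' (x : ℕ) : ℕ := x / 2 % 2

/-- Keep a chain when the given number is one. -/
def csel (n : ℕ) (c : KChain) : KChain := if n = 1 then c else ([], [])

/-- Right hand side of the homotopy identity. -/
def rhs (x y z : ℕ) : KChain :=
  cadd (bdry (hThree.getD (code3 x y z) ([], [])))
  (cadd (cadd (csub (q2 y z) (q2 (x ^^^ y) z)) (csub (q2 x (y ^^^ z)) (q2 x y)))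
  (cadd (cadd (csel (bit0' x * bit0' y * bit0' z) gA) (csel (bit0' x * bit0' y * bit1' z) gB))
   (cadd (csel (bit0' x * bit1' y * bit1' z) gC) (csel (bit1' x * bit1' y * bit1' z) gD))))

theorem rhs_check : ∀ x < 4, ∀ y < 4, ∀ z < 4, ceqv ([code3 x y z], []) (rhs x y z) = true := by
  decide +kernel

section eval
variable {A : Type*} [AddCommGroup A] (w : ℕ → A)

/-- Value of a list of basis elements. -/
def evl (l : List ℕ) : A := (l.map w).sum

/-- Value of a formal combination. -/
def ev (c : KChain) : A := evl w c.1 - evl w c.2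

theorem evl_append (l m : List ℕ) : evl w (l ++ m) = evl w l + evl w m := by simp [evl]

theorem ev_add (c d : KChain) : ev w (cadd c d) = ev w c + ev w d := by
  simp only [ev, cadd, evl_append]; abel

theorem ev_sub (c d : KChain) : ev w (csub c d) = ev w c - ev w d := by
  simp only [ev, csub, evl_append]; abel

theorem ev_nil : ev w ([], []) = 0 := by simp [ev]

theorem ev_sel {n : ℕ} (hn : n = 0 ∨ n = 1) (c : KChain) : ev w (csel n c) = n • ev w c := by
  rcases hn with rfl | rfl <;> simp [csel, ev_nil]

theorem ev_eqv {c d : KChain} (h : ceqv c d = true) : ev w c = ev w d := by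
  have h1 := (List.isPerm_iff.1 h).map w
  have h2 := h1.sum_eq
  simp only [List.map_append, List.sum_append] at h2
  simp only [ev, evl]
  rw [sub_eq_sub_iff_add_eq_add]; exact h2

theorem evl_flatMap (hw : ∀ n, evl w (faceP n) = evl w (faceN n)) (l : List ℕ) :
    evl w (l.flatMap faceP) = evl w (l.flatMap faceN) := by
  induction l with
  | nil => rfl
  | cons a l ih => simp only [List.flatMap_cons, evl_append, ih, hw]

theorem ev_bdry (hw : ∀ n, evl w (faceP n) = evl w (faceN n)) (c : KChain) :
    ev w (bdry c) = 0 := by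
  simp only [ev, bdry, evl_append, evl_flatMap w hw]; abel

end eval

theorem bit0_cases (x : ℕ) : bit0' x = 0 ∨ bit0' x = 1 := by unfold bit0'; omega
theorem bit1_cases (x : ℕ) : bit1' x = 0 ∨ bit1' x = 1 := by unfold bit1'; omega

theorem mul_cases {a b : ℕ} (ha : a = 0 ∨ a = 1) (hb : b = 0 ∨ b = 1) :
    a * b = 0 ∨ a * b = 1 := by
  rcases ha with rfl | rfl <;> simp [hb]

/-- The cocycle condition on functions of three variables in `{0,1,2,3}` with `xor`. -/
def IsCoc {A : Type*} [AddCommGroup A] (u : ℕ → ℕ → ℕ → A) : Prop :=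
  ∀ a < 4, ∀ b < 4, ∀ c < 4, ∀ d < 4,
    u b c d - u (a ^^^ b) c d + u a (b ^^^ c) d - u a b (c ^^^ d) + u a b c = 0

/-- The two-dimensional bits relation. -/
theorem bits_rel : ∀ x < 4, ∀ y < 4, ∀ z < 4,
    ((bit0' y * bit1' z : ℕ) : ℤ) - (bit0' (x ^^^ y) * bit1' z : ℕ)
      + (bit0' x * bit1' (y ^^^ z) : ℕ) - (bit0' x * bit1' y : ℕ)
      = 2 * ((bit0' x * bit0' y * bit1' z : ℕ) - (bit0' x * bit1' y * bit1' z : ℕ)) := by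
  decide

theorem xor_lt : ∀ x < 4, ∀ y < 4, x ^^^ y < 4 := by decide

theorem core {A : Type*} [AddCommGroup A] (hdiv : ∀ a : A, ∃ r : A, r + r = a)
    (u : ℕ → ℕ → ℕ → A) (hu : IsCoc u)
    (hc : ∀ g < 4, u g g g + u g 0 g = 0) :
    ∃ v : ℕ → ℕ → A, ∀ x < 4, ∀ y < 4, ∀ z < 4,
      v y z - v (x ^^^ y) z + v x (y ^^^ z) - v x y = u x y z := by
  let w : ℕ → A := fun n => u (n / 16 % 4) (n / 4 % 4) (n % 4)
  have hwc : ∀ x < 4, ∀ y < 4, ∀ z < 4, w (code3 x y z) = u x y z := by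
    intro x hx y hy z hz
    have h1 : (16 * x + 4 * y + z) / 16 % 4 = x := by omega
    have h2 : (16 * x + 4 * y + z) / 4 % 4 = y := by omega
    have h3 : (16 * x + 4 * y + z) % 4 = z := by omega
    simp only [w, code3, h1, h2, h3]
  have hw : ∀ n, evl w (faceP n) = evl w (faceN n) := by
    intro n
    have ha : n / 64 % 4 < 4 := Nat.mod_lt _ (by norm_num)
    have hb : n / 16 % 4 < 4 := Nat.mod_lt _ (by norm_num)
    have hc : n / 4 % 4 < 4 := Nat.mod_lt _ (by norm_num)
    have hd : n % 4 < 4 := Nat.mod_lt _ (by norm_num)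
    have := hu _ ha _ hb _ hc _ hd
    simp only [evl, faceP, faceN, List.map_cons, List.map_nil, List.sum_cons, List.sum_nil]
    rw [hwc _ hb _ hc _ hd, hwc _ ha _ (xor_lt _ hb _ hc) _ hd, hwc _ ha _ hb _ hc,
      hwc _ (xor_lt _ ha _ hb) _ hc _ hd, hwc _ ha _ hb _ (xor_lt _ hc _ hd)]
    rw [← sub_eq_zero, ← this]
    abel
  let q : ℕ → ℕ → A := fun x y => ev w (q2 x y)
  have key : ∀ x < 4, ∀ y < 4, ∀ z < 4, u x y z =
      (q y z - q (x ^^^ y) z + (q x (y ^^^ z) - q x y)) +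
      ((bit0' x * bit0' y * bit0' z) • ev w gA + (bit0' x * bit0' y * bit1' z) • ev w gB +
      ((bit0' x * bit1' y * bit1' z) • ev w gC + (bit1' x * bit1' y * bit1' z) • ev w gD)) := by
    intro x hx y hy z hz
    have h := ev_eqv w (rhs_check x hx y hy z hz)
    have h0 : ev w ([code3 x y z], []) = u x y z := by
      simp [ev, evl, hwc x hx y hy z hz]
    rw [h0] at h
    rw [h, rhs]
    simp only [ev_add, ev_sub, ev_bdry w hw, zero_add]
    rw [ev_sel w (mul_cases (mul_cases (bit0_cases x) (bit0_cases y)) (bit0_cases z)),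
      ev_sel w (mul_cases (mul_cases (bit0_cases x) (bit0_cases y)) (bit1_cases z)),
      ev_sel w (mul_cases (mul_cases (bit0_cases x) (bit1_cases y)) (bit1_cases z)),
      ev_sel w (mul_cases (mul_cases (bit1_cases x) (bit1_cases y)) (bit1_cases z))]
  have hA : ev w gA = 0 := by
    have h := hc 1 (by norm_num)
    rw [key 1 (by norm_num) 1 (by norm_num) 1 (by norm_num),
      key 1 (by norm_num) 0 (by norm_num) 1 (by norm_num)] at h
    simp [bit0', bit1'] at h
    rw [← h]; abel
  have hD : ev w gD = 0 := by
    have h := hc 2 (by norm_num)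
    rw [key 2 (by norm_num) 2 (by norm_num) 2 (by norm_num),
      key 2 (by norm_num) 0 (by norm_num) 2 (by norm_num)] at h
    simp [bit0', bit1'] at h
    rw [← h]; abel
  have hBC : ev w gB + ev w gC = 0 := by
    have h := hc 3 (by norm_num)
    rw [key 3 (by norm_num) 3 (by norm_num) 3 (by norm_num),
      key 3 (by norm_num) 0 (by norm_num) 3 (by norm_num)] at h
    simp [bit0', bit1', hA, hD] at h
    rw [← h]; abel
  obtain ⟨r, hr⟩ := hdiv (ev w gB)
  have hC : ev w gC = - ev w gB := by rw [eq_neg_iff_add_eq_zero, add_comm]; exact hBC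
  refine ⟨fun x y => q x y + ((bit0' x * bit1' y : ℕ) : ℤ) • r, ?_⟩
  intro x hx y hy z hz
  rw [key x hx y hy z hz, hA, hD, hC, ← hr]
  have hb := congrArg (fun t : ℤ => t • r) (bits_rel x hx y hy z hz)
  simp only [add_smul, sub_smul, mul_smul] at hb
  simp only [← natCast_zsmul, smul_zero, smul_neg, smul_add, zero_add, add_zero]
  have e : ∀ a b c d a' b' c' d' : A,
    a + a' - (b + b') + (c + c') - (d + d') = (a - b + (c - d)) + (a' - b' + c' - d') := by
    intros; abel
  rw [e, hb, two_smul]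
  abel

/-- The Klein four-group. -/
abbrev V4 := Multiplicative (ZMod 2 × ZMod 2)

/-- The coefficients: nonzero complex numbers with trivial action. -/
noncomputable abbrev M : Rep ℤ V4 := Rep.trivial ℤ V4 (Additive ℂˣ)

/-- The elements of the Klein four-group, by codes. -/
def dec (n : ℕ) : V4 := Multiplicative.ofAdd ((n : ZMod 2), ((n / 2 : ℕ) : ZMod 2))

/-- The code of an element of the Klein four-group. -/
def enc (g : V4) : ℕ := g.toAdd.1.val + 2 * g.toAdd.2.val

theorem dec_enc : ∀ g : V4, dec (enc g) = g := by decide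
theorem enc_lt : ∀ g : V4, enc g < 4 := by decide
theorem enc_dec : ∀ n < 4, enc (dec n) = n := by decide
theorem dec_xor : ∀ a < 4, ∀ b < 4, dec (a ^^^ b) = dec a * dec b := by decide
theorem enc_mul : ∀ a b : V4, enc (a * b) = enc a ^^^ enc b := by decide
theorem dec_zero : dec 0 = 1 := by decide

theorem d_three (f : (Fin 3 → V4) → Additive ℂˣ) (a b c d : V4) :
    (inhomogeneousCochains.d M 3 f : (Fin 4 → V4) → Additive ℂˣ) ![a, b, c, d] =
      f ![b, c, d] - f ![a * b, c, d] + f ![a, b * c, d] - f ![a, b, c * d] + f ![a, b, c] := by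
  have h0 : (fun i : Fin 3 => (![a, b, c, d] : Fin 4 → V4) i.succ) = ![b, c, d] := by
    funext i; fin_cases i <;> rfl
  have h1 : Fin.contractNth 0 (· * ·) (![a, b, c, d] : Fin 4 → V4) = ![a * b, c, d] := by
    funext i; fin_cases i <;> rfl
  have h2 : Fin.contractNth 1 (· * ·) (![a, b, c, d] : Fin 4 → V4) = ![a, b * c, d] := by
    funext i; fin_cases i <;> rfl
  have h3 : Fin.contractNth 2 (· * ·) (![a, b, c, d] : Fin 4 → V4) = ![a, b, c * d] := by
    funext i; fin_cases i <;> rfl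
  have h4 : Fin.contractNth 3 (· * ·) (![a, b, c, d] : Fin 4 → V4) = ![a, b, c] := by
    funext i; fin_cases i <;> rfl
  have := inhomogeneousCochains.d_hom_apply M 3 f ![a, b, c, d]
  refine this.trans ?_
  rw [Fin.sum_univ_four, h0, h1, h2, h3, h4]
  change f ![b, c, d] + ((-1 : ℤ) ^ 1 • f ![a * b, c, d] + (-1 : ℤ) ^ 2 • f ![a, b * c, d]
    + (-1 : ℤ) ^ 3 • f ![a, b, c * d] + (-1 : ℤ) ^ 4 • f ![a, b, c]) = _
  norm_num
  abel

theorem d_two (f : (Fin 2 → V4) → Additive ℂˣ) (a b c : V4) :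
    (inhomogeneousCochains.d M 2 f : (Fin 3 → V4) → Additive ℂˣ) ![a, b, c] =
      f ![b, c] - f ![a * b, c] + f ![a, b * c] - f ![a, b] := by
  have h0 : (fun i : Fin 2 => (![a, b, c] : Fin 3 → V4) i.succ) = ![b, c] := by
    funext i; fin_cases i <;> rfl
  have h1 : Fin.contractNth 0 (· * ·) (![a, b, c] : Fin 3 → V4) = ![a * b, c] := by
    funext i; fin_cases i <;> rfl
  have h2 : Fin.contractNth 1 (· * ·) (![a, b, c] : Fin 3 → V4) = ![a, b * c] := by
    funext i; fin_cases i <;> rfl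
  have h3 : Fin.contractNth 2 (· * ·) (![a, b, c] : Fin 3 → V4) = ![a, b] := by
    funext i; fin_cases i <;> rfl
  have := inhomogeneousCochains.d_hom_apply M 2 f ![a, b, c]
  refine this.trans ?_
  rw [Fin.sum_univ_three, h0, h1, h2, h3]
  change f ![b, c] + ((-1 : ℤ) ^ 1 • f ![a * b, c] + (-1 : ℤ) ^ 2 • f ![a, b * c]
    + (-1 : ℤ) ^ 3 • f ![a, b]) = _
  norm_num
  abel

theorem vec3 {α : Type*} (g : Fin 3 → α) : g = ![g 0, g 1, g 2] := by
  ext i; fin_cases i <;> rfl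

theorem vec4 {α : Type*} (g : Fin 4 → α) : g = ![g 0, g 1, g 2, g 3] := by
  ext i; fin_cases i <;> rfl

theorem divTwo (a : Additive ℂˣ) : ∃ r : Additive ℂˣ, r + r = a := by
  obtain ⟨z, hz⟩ := IsAlgClosed.exists_pow_nat_eq (a.toMul : ℂ) (n := 2) (by norm_num)
  have hz0 : z ≠ 0 := by
    rintro rfl
    exact a.toMul.ne_zero (by rw [← hz]; norm_num)
  refine ⟨Additive.ofMul (Units.mk0 z hz0), ?_⟩
  apply Additive.toMul.injective
  ext
  simp [← hz, sq]

/-- The inclusion of the group of order two as the signs. -/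
noncomputable def iota : ZMod 2 →+ Additive ℂˣ :=
  ZMod.lift 2 ⟨zmultiplesHom _ (Additive.ofMul (-1 : ℂˣ)), by
    apply Additive.toMul.injective
    simp⟩

theorem iota_one : iota 1 = Additive.ofMul (-1 : ℂˣ) := by
  have := ZMod.lift_coe 2 ⟨zmultiplesHom _ (Additive.ofMul (-1 : ℂˣ)), by
    apply Additive.toMul.injective
    simp⟩ 1
  simpa [iota] using this

theorem zmod_two_cases : ∀ x : ZMod 2, x = 0 ∨ x = 1 := by decide

theorem iota_eq_zero {x : ZMod 2} (h : iota x = 0) : x = 0 := by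
  rcases zmod_two_cases x with rfl | rfl
  · rfl
  · rw [iota_one] at h
    have h2 : (-1 : ℂˣ) = 1 := congrArg Additive.toMul h
    have h3 := congrArg Units.val h2
    norm_num at h3

theorem exists_iota {a : Additive ℂˣ} (h : a + a = 0) : ∃ x, iota x = a := by
  have h1 : (a.toMul : ℂ) * a.toMul = 1 := by
    have := congrArg (fun t : Additive ℂˣ => (t.toMul : ℂ)) h
    simpa using this
  rcases mul_self_eq_one_iff.1 h1 with h2 | h2
  · refine ⟨0, ?_⟩
    rw [map_zero]
    apply Additive.toMul.injective
    ext
    simp [h2]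
  · refine ⟨1, ?_⟩
    rw [iota_one]
    apply Additive.toMul.injective
    ext
    simp [h2]

/-- A trilinear form on the Klein four-group. -/
def tri (p : ZMod 2 × ZMod 2 × ZMod 2) (x y z : V4) : ZMod 2 :=
  p.1 * (x.toAdd.1 * y.toAdd.1 * z.toAdd.1) + p.2.1 * (x.toAdd.2 * y.toAdd.2 * z.toAdd.2)
    + p.2.2 * (x.toAdd.1 * y.toAdd.1 * z.toAdd.2)

theorem tri_coc (p : ZMod 2 × ZMod 2 × ZMod 2) (a b c d : V4) :
    tri p b c d - tri p (a * b) c d + tri p a (b * c) d - tri p a b (c * d) + tri p a b c = 0 := by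
  simp only [tri, toAdd_mul, Prod.fst_add, Prod.snd_add]
  ring

/-- The explicit cochain attached to a trilinear form. -/
noncomputable def cochain : (ZMod 2 × ZMod 2 × ZMod 2) →+ ((Fin 3 → V4) → Additive ℂˣ) where
  toFun p := fun g => iota (tri p (g 0) (g 1) (g 2))
  map_zero' := by ext g; simp [tri]
  map_add' p q := by
    funext g
    simp only [Pi.add_apply, ← map_add]
    congr 1
    simp only [tri, Prod.fst_add, Prod.snd_add]
    ring

theorem cochain_coc (p) : inhomogeneousCochains.d M 3 (cochain p) = 0 := by
  funext g
  rw [vec4 g]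
  refine (d_three _ _ _ _ _).trans ?_
  change iota (tri p _ _ _) - iota (tri p _ _ _) + iota (tri p _ _ _) - iota (tri p _ _ _)
    + iota (tri p _ _ _) = 0
  rw [← map_sub, ← map_add, ← map_sub, ← map_add]
  refine (congrArg iota (tri_coc p (g 0) (g 1) (g 2) (g 3))).trans (map_zero _)

/-- The value of a cochain on the fundamental cycle of the subgroup generated by `g`. -/
def cyc (f : (Fin 3 → V4) → Additive ℂˣ) (g : V4) : Additive ℂˣ := f ![g, g, g] + f ![g, 1, g]

theorem V4_sq : ∀ g : V4, g * g = 1 := by decide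

theorem cyc_d (f : (Fin 2 → V4) → Additive ℂˣ) (g : V4) :
    cyc (inhomogeneousCochains.d M 2 f) g = 0 := by
  unfold cyc
  rw [d_two, d_two, V4_sq, mul_one, one_mul]
  abel

theorem cyc_two (f : (Fin 3 → V4) → Additive ℂˣ) (hf : inhomogeneousCochains.d M 3 f = 0)
    (g : V4) : cyc f g + cyc f g = 0 := by
  have h : ∀ a b c d : V4, f ![b, c, d] - f ![a * b, c, d] + f ![a, b * c, d] - f ![a, b, c * d]
      + f ![a, b, c] = 0 := fun a b c d => (d_three f a b c d).symm.trans (congrFun hf _)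
  have h1 := h g g g g
  have h2 := h g g 1 g
  have h3 := h 1 1 g g
  have h4 := h 1 1 1 1
  simp only [V4_sq, one_mul, mul_one] at h1 h2 h3 h4
  have e : cyc f g + cyc f g = 0 + 0 + 0 + 0 := by
    conv_rhs => enter [1, 1, 1]; rw [← h1]
    conv_rhs => enter [1, 1, 2]; rw [← h2]
    conv_rhs => enter [1, 2]; rw [← h3]
    conv_rhs => enter [2]; rw [← h4]
    unfold cyc
    abel
  simpa using e

theorem exact3 (f : (Fin 3 → V4) → Additive ℂˣ) (hf : inhomogeneousCochains.d M 3 f = 0)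
    (hc : ∀ g : V4, cyc f g = 0) :
    ∃ b : (Fin 2 → V4) → Additive ℂˣ, inhomogeneousCochains.d M 2 b = f := by
  have h : ∀ a b c d : V4, f ![b, c, d] - f ![a * b, c, d] + f ![a, b * c, d] - f ![a, b, c * d]
      + f ![a, b, c] = 0 := fun a b c d => (d_three f a b c d).symm.trans (congrFun hf _)
  obtain ⟨v, hv⟩ := core divTwo (fun x y z => f ![dec x, dec y, dec z])
    (by
      intro a ha b hb c hc d hd
      simp only [dec_xor a ha b hb, dec_xor b hb c hc, dec_xor c hc d hd]
      exact h _ _ _ _)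
    (by
      intro g hg
      simp only [dec_zero]
      exact hc (dec g))
  refine ⟨fun g => v (enc (g 0)) (enc (g 1)), ?_⟩
  funext g
  rw [vec3 g]
  refine (d_two _ _ _ _).trans ?_
  have := hv _ (enc_lt (g 0)) _ (enc_lt (g 1)) _ (enc_lt (g 2))
  simp only [dec_enc, ← enc_mul] at this
  exact this

theorem cyc_cochain (p) (g : V4) : cyc (cochain p) g = iota (tri p g g g + tri p g 1 g) :=
  (map_add iota _ _).symm

/-- Cocycles from trilinear forms. -/
noncomputable def toCoc (p : ZMod 2 × ZMod 2 × ZMod 2) : groupCohomology.cocycles M 3 :=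
  groupCohomology.cocyclesMk (A := M) (cochain p) (cochain_coc p)

theorem iCocycles_inj : Function.Injective (groupCohomology.iCocycles M 3) :=
  (ModuleCat.mono_iff_injective _).1 inferInstance

theorem i_toCoc (p) : groupCohomology.iCocycles M 3 (toCoc p) = cochain p :=
  groupCohomology.iCocycles_mk (A := M) _ (cochain_coc p)

theorem d_iCocycles (x : groupCohomology.cocycles M 3) :
    inhomogeneousCochains.d M 3 (groupCohomology.iCocycles M 3 x) = 0 := by
  have h := (groupCohomology.inhomogeneousCochains M).iCycles_d 3 4
  rw [groupCohomology.inhomogeneousCochains.d_def] at h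
  have h2 := congrArg (fun t => t.hom x) h
  exact h2

theorem pi_eq_zero_iff (x : groupCohomology.cocycles M 3) :
    groupCohomology.π M 3 x = 0 ↔ ∃ b : (Fin 2 → V4) → Additive ℂˣ,
      inhomogeneousCochains.d M 2 b = groupCohomology.iCocycles M 3 x := by
  let K := groupCohomology.inhomogeneousCochains M
  have hex : (CategoryTheory.ShortComplex.mk _ _ (K.toCycles_comp_homologyπ 2 3)).Exact :=
    CategoryTheory.ShortComplex.exact_of_g_is_cokernel _ (K.homologyIsCokernel 2 3 (by simp))
  have hti : ∀ b : (Fin 2 → V4) → Additive ℂˣ, groupCohomology.iCocycles M 3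
      (groupCohomology.toCocycles M 2 3 b) = inhomogeneousCochains.d M 2 b := by
    intro b
    have h := K.toCycles_i 2 3
    rw [groupCohomology.inhomogeneousCochains.d_def] at h
    exact congrArg (fun t => t.hom b) h
  constructor
  · intro h
    obtain ⟨b, hb⟩ := (CategoryTheory.ShortComplex.moduleCat_exact_iff _).1 hex x h
    refine ⟨b, (hti b).symm.trans ?_⟩
    exact congrArg _ hb
  · rintro ⟨b, hb⟩
    have hx : groupCohomology.toCocycles M 2 3 b = x := iCocycles_inj ((hti b).trans hb)
    rw [← hx]
    exact congrArg (fun t => t.hom b) (K.toCycles_comp_homologyπ 2 3)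

/-- The comparison map. -/
noncomputable def psi : (ZMod 2 × ZMod 2 × ZMod 2) →+ groupCohomology M 3 :=
  AddMonoidHom.mk' (fun p => groupCohomology.π M 3 (toCoc p)) (by
    intro p q
    rw [← map_add]
    congr 1
    apply iCocycles_inj
    rw [map_add, i_toCoc, i_toCoc, i_toCoc, map_add])

theorem psi_injective : Function.Injective psi := by
  rw [injective_iff_map_eq_zero]
  intro p hp
  obtain ⟨b, hb⟩ := (pi_eq_zero_iff _).1 hp
  rw [i_toCoc] at hb
  have h : ∀ g, tri p g g g + tri p g 1 g = 0 := fun g => by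
    apply iota_eq_zero
    rw [← cyc_cochain, ← hb, cyc_d]
  have key : ∀ p, (∀ g, tri p g g g + tri p g 1 g = 0) → p = 0 := by decide
  exact key p h

theorem psi_surjective : Function.Surjective psi := by
  intro y
  induction y using groupCohomology_induction_on with
  | h x =>
    set f : (Fin 3 → V4) → Additive ℂˣ := groupCohomology.iCocycles M 3 x with hfdef
    have hf : inhomogeneousCochains.d M 3 f = 0 := d_iCocycles x
    choose s hs using fun g => exists_iota (cyc_two f hf g)
    have hone : cyc f 1 = 0 := by
      have h : f ![1, 1, 1] - f ![1 * 1, 1, 1] + f ![1, 1 * 1, 1] - f ![1, 1, 1 * 1]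
        + f ![1, 1, 1] = 0 := (d_three f 1 1 1 1).symm.trans (congrFun hf _)
      simp only [mul_one, sub_self, zero_add] at h
      have h' : f ![1, 1, 1] = 0 := by simpa using h
      simp [cyc, h']
    have hs1 : s 1 = 0 := iota_eq_zero ((hs 1).trans hone)
    have key : ∀ i j k : ZMod 2, ∃ p, ∀ g : V4, tri p g g g + tri p g 1 g =
        if g = 1 then 0 else if g = dec 1 then i else if g = dec 2 then j else k := by
      decide
    have cases4 : ∀ g : V4, g = 1 ∨ g = dec 1 ∨ g = dec 2 ∨ g = dec 3 := by decide
    have n1 : dec 1 ≠ 1 := by decide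
    have n2 : dec 2 ≠ 1 ∧ dec 2 ≠ dec 1 := by decide
    have n3 : dec 3 ≠ 1 ∧ dec 3 ≠ dec 1 ∧ dec 3 ≠ dec 2 := by decide
    obtain ⟨p, hp⟩ := key (s (dec 1)) (s (dec 2)) (s (dec 3))
    have hp' : ∀ g, tri p g g g + tri p g 1 g = s g := by
      intro g
      rw [hp]
      rcases cases4 g with rfl | rfl | rfl | rfl
      · simp [hs1]
      · simp [n1]
      · simp [n2]
      · simp [n3]
    refine ⟨p, ?_⟩
    change groupCohomology.π M 3 (toCoc p) = _
    rw [← sub_eq_zero, ← map_sub, pi_eq_zero_iff]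
    obtain ⟨b, hb⟩ := exact3 (cochain p - f) (by
        have := d_iCocycles (toCoc p - x)
        rw [map_sub, i_toCoc] at this
        exact this) (by
      intro g
      have h1 := cyc_cochain p g
      rw [hp', hs] at h1
      have : cyc (cochain p - f) g = cyc (cochain p) g - cyc f g := by
        simp only [cyc, Pi.sub_apply]; abel
      rw [this, h1, sub_self])
    refine ⟨b, ?_⟩
    rw [map_sub, i_toCoc]
    exact hb

end KleinH3

/-- `H³(ℤ/2ℤ × ℤ/2ℤ, ℂˣ) ≅ (ℤ/2ℤ)³` as abelian groups, where `ℂˣ`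
carries the trivial action (encoded as the trivial representation of the Klein
four-group on `Additive ℂˣ`). -/
theorem statement16 :
    Nonempty
      ((groupCohomology
          (Rep.trivial ℤ (Multiplicative (ZMod 2 × ZMod 2)) (Additive ℂˣ)) 3) ≃+
        (ZMod 2 × ZMod 2 × ZMod 2)) :=
  ⟨(AddEquiv.ofBijective KleinH3.psi
    ⟨KleinH3.psi_injective, KleinH3.psi_surjective⟩).symm⟩
end

section
/- The third group cohomology of the quaternion group Q₈ of order 8 with coefficients in ℂˣ (with trivial action) is cyclic of order 8: H³(Q₈, ℂˣ) ≅ ℤ/8ℤ as abelian groups. -/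
open CategoryTheory

set_option linter.unusedSimpArgs false
set_option linter.unnecessarySeqFocus false

namespace Q8

/-- The quaternion group of order 8. -/
abbrev Q : Type := QuaternionGroup 2

/-- An element of `Q₈`. -/
def g0 : Q := QuaternionGroup.a 0

/-- An element of `Q₈`. -/
def g1 : Q := QuaternionGroup.a 1

/-- An element of `Q₈`. -/
def g2 : Q := QuaternionGroup.a 2

/-- An element of `Q₈`. -/
def g3 : Q := QuaternionGroup.a 3

/-- An element of `Q₈`. -/
def g4 : Q := QuaternionGroup.xa 0

/-- An element of `Q₈`. -/
def g5 : Q := QuaternionGroup.xa 1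

/-- An element of `Q₈`. -/
def g6 : Q := QuaternionGroup.xa 2

/-- An element of `Q₈`. -/
def g7 : Q := QuaternionGroup.xa 3

lemma forallQ {p : Q → Prop} : (∀ h, p h) ↔
    p g0 ∧ p g1 ∧ p g2 ∧ p g3 ∧ p g4 ∧ p g5 ∧ p g6 ∧ p g7 := by
  constructor
  · intro h
    exact ⟨h _, h _, h _, h _, h _, h _, h _, h _⟩
  · rintro ⟨h0, h1, h2, h3, h4, h5, h6, h7⟩ (i | i)
    · fin_cases i
      exacts [h0, h1, h2, h3]
    · fin_cases i
      exacts [h4, h5, h6, h7]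

lemma sumQ {M : Type*} [AddCommMonoid M] (f : Q → M) :
    ∑ h, f h = f g0 + f g1 + f g2 + f g3 + f g4 + f g5 + f g6 + f g7 := by
  have : (Finset.univ : Finset Q) = {g0, g1, g2, g3, g4, g5, g6, g7} := by decide
  rw [this]
  repeat rw [Finset.sum_insert (by decide)]
  rw [Finset.sum_singleton]
  simp only [add_assoc]

lemma mul_g3 : g0 * g3 = g3 ∧ g1 * g3 = g0 ∧ g2 * g3 = g1 ∧ g3 * g3 = g2 ∧ g4 * g3 = g7 ∧ g5 * g3 = g4 ∧ g6 * g3 = g5 ∧ g7 * g3 = g6 := by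
  decide

lemma mul_g5 : g0 * g5 = g5 ∧ g1 * g5 = g4 ∧ g2 * g5 = g7 ∧ g3 * g5 = g6 ∧ g4 * g5 = g3 ∧ g5 * g5 = g2 ∧ g6 * g5 = g1 ∧ g7 * g5 = g0 := by
  decide

lemma mul_g6 : g0 * g6 = g6 ∧ g1 * g6 = g5 ∧ g2 * g6 = g4 ∧ g3 * g6 = g7 ∧ g4 * g6 = g0 ∧ g5 * g6 = g3 ∧ g6 * g6 = g2 ∧ g7 * g6 = g1 := by
  decide

/-- A function on `Q₈` from its values. -/
def mk (v0 v1 v2 v3 v4 v5 v6 v7 : ℤ) : Q → ℤ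
  | .a i => ![v0, v1, v2, v3] i
  | .xa i => ![v4, v5, v6, v7] i

lemma mk_apply (v0 v1 v2 v3 v4 v5 v6 v7 : ℤ) :
    mk v0 v1 v2 v3 v4 v5 v6 v7 g0 = v0 ∧ mk v0 v1 v2 v3 v4 v5 v6 v7 g1 = v1 ∧ mk v0 v1 v2 v3 v4 v5 v6 v7 g2 = v2 ∧ mk v0 v1 v2 v3 v4 v5 v6 v7 g3 = v3 ∧ mk v0 v1 v2 v3 v4 v5 v6 v7 g4 = v4 ∧ mk v0 v1 v2 v3 v4 v5 v6 v7 g5 = v5 ∧ mk v0 v1 v2 v3 v4 v5 v6 v7 g6 = v6 ∧ mk v0 v1 v2 v3 v4 v5 v6 v7 g7 = v7 :=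
  ⟨rfl, rfl, rfl, rfl, rfl, rfl, rfl, rfl⟩

/-- First differential. -/
def D1 : (Fin 2 → Q → ℤ) →ₗ[ℤ] (Fin 1 → Q → ℤ) where
  toFun f := ![fun h => f 0 (h * g3) - f 0 h + f 1 (h * g6) - f 1 h]
  map_add' f f' := by
    ext i h
    fin_cases i <;> simp <;> ring
  map_smul' c f := by
    ext i h
    fin_cases i <;> simp <;> ring

/-- Second differential. -/
def D2 : (Fin 2 → Q → ℤ) →ₗ[ℤ] (Fin 2 → Q → ℤ) where
  toFun f := ![fun h => f 0 h + f 0 (h * g3) + f 1 (h * g5) + f 1 h, fun h => - f 0 (h * g6) - f 0 h + f 1 (h * g3) - f 1 h]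
  map_add' f f' := by
    ext i h
    fin_cases i <;> simp <;> ring
  map_smul' c f := by
    ext i h
    fin_cases i <;> simp <;> ring

/-- Third differential. -/
def D3 : (Fin 1 → Q → ℤ) →ₗ[ℤ] (Fin 2 → Q → ℤ) where
  toFun f := ![fun h => f 0 (h * g3) - f 0 h, fun h => - f 0 (h * g5) + f 0 h]
  map_add' f f' := by
    ext i h
    fin_cases i <;> simp <;> ring
  map_smul' c f := by
    ext i h
    fin_cases i <;> simp <;> ring

/-- Fourth differential (norm). -/
def D4 : (Fin 1 → Q → ℤ) →ₗ[ℤ] (Fin 1 → Q → ℤ) where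
  toFun f := ![fun h => f 0 g0 + f 0 g1 + f 0 g2 + f 0 g3 + f 0 g4 + f 0 g5 + f 0 g6 + f 0 g7]
  map_add' f f' := by
    ext i h
    fin_cases i <;> simp <;> ring
  map_smul' c f := by
    ext i h
    fin_cases i <;> simp <;> ring

lemma exact0 (f : Fin 1 → Q → ℤ) (hf : f 0 g0 + f 0 g1 + f 0 g2 + f 0 g3 + f 0 g4 + f 0 g5 + f 0 g6 + f 0 g7 = 0) : ∃ e, D1 e = f := by
  refine ⟨![mk (f 0 g1 + f 0 g2 + f 0 g3 + f 0 g4 + f 0 g5 + f 0 g6 + f 0 g7) (f 0 g2 + f 0 g3 + f 0 g4 + f 0 g5 + f 0 g6 + f 0 g7) (f 0 g3 + f 0 g4 + f 0 g5 + f 0 g6 + f 0 g7) (0) (- f 0 g4) (f 0 g6 + f 0 g7) (f 0 g7) (0), mk (0) (0) (0) (f 0 g4 + f 0 g5 + f 0 g6 + f 0 g7) (0) (0) (0) (0)], ?_⟩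
  have h0 := hf
  have := h0
  ext i h
  revert h
  rw [forallQ]
  fin_cases i <;> simp [D1, mul_g3, mul_g5, mul_g6, mk_apply] <;> grind

lemma exact1 (f : Fin 2 → Q → ℤ) (hf : D1 f = 0) : ∃ e, D2 e = f := by
  refine ⟨![mk (f 0 g3 - f 1 g0 + f 1 g6) (- f 1 g7) (- f 0 g7 - f 1 g6) (0) (- f 0 g3 + f 1 g0 - f 1 g4 - f 1 g6) (- f 1 g5) (f 0 g7) (0), mk (0) (- f 1 g1 + f 1 g5 + f 1 g7) (f 0 g3 + f 0 g7 - f 1 g0 - f 1 g1 - f 1 g2 + f 1 g4 + f 1 g5 + 2 * f 1 g6 + f 1 g7) (f 0 g3 + f 0 g7 + f 1 g6) (0) (0) (0) (0)], ?_⟩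
  have h0 := fun i => forallQ.1 (congrFun (congrFun hf i))
  replace h0 := h0 0
  simp [D1, mul_g3, mul_g5, mul_g6] at h0
  ext i h
  revert h
  rw [forallQ]
  fin_cases i <;> simp [D2, mul_g3, mul_g5, mul_g6, mk_apply] <;> grind

lemma exact2 (f : Fin 2 → Q → ℤ) (hf : D2 f = 0) : ∃ e, D3 e = f := by
  refine ⟨![mk (- f 1 g7) (f 0 g7 - f 1 g6) (- f 1 g0 - f 1 g5 - f 1 g7) (- f 0 g3 - f 1 g0 - f 1 g5 - f 1 g7) (- f 0 g3 - f 1 g0 + f 1 g4 - f 1 g5 - f 1 g7) (- f 1 g0 - f 1 g7) (f 0 g7) (0)], ?_⟩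
  have h0 := fun i => forallQ.1 (congrFun (congrFun hf i))
  simp only [Fin.forall_fin_two] at h0
  simp [D2, mul_g3, mul_g5, mul_g6] at h0
  ext i h
  revert h
  rw [forallQ]
  fin_cases i <;> simp [D3, mul_g3, mul_g5, mul_g6, mk_apply] <;> grind

lemma exact3 (f : Fin 1 → Q → ℤ) (hf : D3 f = 0) : ∃ e, D4 e = f := by
  refine ⟨![mk (f 0 g7) (0) (0) (0) (0) (0) (0) (0)], ?_⟩
  have h0 := fun i => forallQ.1 (congrFun (congrFun hf i))
  simp only [Fin.forall_fin_two] at h0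
  simp [D3, mul_g3, mul_g5, mul_g6] at h0
  ext i h
  revert h
  rw [forallQ]
  fin_cases i <;> simp [D4, mul_g3, mul_g5, mul_g6, mk_apply] <;> grind

lemma exact4 (f : Fin 1 → Q → ℤ) (hf : D4 f = 0) : ∃ e, D1 e = f :=
  exact0 f (by simpa [D4] using congrFun (congrFun hf 0) g0)

lemma D1_D2 (f : Fin 2 → Q → ℤ) : D1 (D2 f) = 0 := by
  ext i h
  revert h
  rw [forallQ]
  fin_cases i <;> simp [D1, D2, mul_g3, mul_g5, mul_g6] <;> grind

lemma D2_D3 (f : Fin 1 → Q → ℤ) : D2 (D3 f) = 0 := by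
  ext i h
  revert h
  rw [forallQ]
  fin_cases i <;> simp [D2, D3, mul_g3, mul_g5, mul_g6] <;> grind

lemma D3_D4 (f : Fin 1 → Q → ℤ) : D3 (D4 f) = 0 := by
  ext i h
  revert h
  rw [forallQ]
  fin_cases i <;> simp [D3, D4, mul_g3, mul_g5, mul_g6] <;> grind

lemma D4_D1 (f : Fin 2 → Q → ℤ) : D4 (D1 f) = 0 := by
  ext i h
  revert h
  rw [forallQ]
  fin_cases i <;> simp [D4, D1, mul_g3, mul_g5, mul_g6] <;> grind

/-- The free representation of rank `n`, as functions. -/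
def rho (k : Type) [CommRing k] (n : ℕ) : Representation k Q (Fin n → Q → k) where
  toFun g :=
    { toFun := fun f i h => f i (g⁻¹ * h)
      map_add' := fun _ _ => rfl
      map_smul' := fun _ _ => rfl }
  map_one' := by
    apply LinearMap.ext
    intro f
    funext i h
    simp
  map_mul' g g' := by
    apply LinearMap.ext
    intro f
    funext i h
    simp [mul_assoc]

lemma rho_apply (k : Type) [CommRing k] (n : ℕ) (g : Q) (f : Fin n → Q → k) (i : Fin n) (h : Q) :
    rho k n g f i h = f i (g⁻¹ * h) := rfl

/-- The free representation of rank `n`. -/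
abbrev F (k : Type) [CommRing k] (n : ℕ) : Rep k Q := Rep.of (rho k n)

/-- Basis elements. -/
def E {k : Type} [CommRing k] {n : ℕ} (i : Fin n) (g : Q) : Fin n → Q → k := fun j h => if i = j ∧ g = h then 1 else 0

lemma rho_E {k : Type} [CommRing k] {n : ℕ} (i : Fin n) (g g' : Q) :
    rho k n g (E i g') = E i (g * g') := by
  funext j h
  simp only [rho_apply, E, eq_inv_mul_iff_mul_eq]

lemma eq_sum {k : Type} [CommRing k] {n : ℕ} (f : Fin n → Q → k) : f = ∑ i, ∑ g, f i g • E i g := by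
  funext j h
  simp [E, Finset.sum_apply, ite_and]

/-- The map out of the free representation. -/
def lift {k : Type} [CommRing k] {n : ℕ} {A : Rep k Q} (x : Fin n → A) : F k n ⟶ A :=
  Rep.ofHom (σ := A.ρ) (LinearMap.intertwiningMap_of_isIntertwiningMap (rho k n) A.ρ
    { toFun := fun f => ∑ i, ∑ g, f i g • A.ρ g (x i)
      map_add' := fun f f' => by simp [add_smul, Finset.sum_add_distrib]
      map_smul' := fun c f => by simp [mul_smul, Finset.smul_sum] } (by
    intro g f
    simp only [LinearMap.coe_mk, AddHom.coe_mk, map_sum, map_smul, rho_apply]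
    refine Finset.sum_congr rfl fun i _ => ?_
    refine Fintype.sum_equiv (Equiv.mulLeft g⁻¹) _ _ fun h => ?_
    simp [← Module.End.mul_apply, ← map_mul]))

lemma lift_apply {k : Type} [CommRing k] {n : ℕ} {A : Rep k Q} (x : Fin n → A) (f : Fin n → Q → k) :
    (lift x).hom f = ∑ i, ∑ g, f i g • A.ρ g (x i) := rfl

lemma lift_E {k : Type} [CommRing k] {n : ℕ} {A : Rep k Q} (x : Fin n → A) (i : Fin n) :
    (lift x).hom (E i 1) = x i := by
  erw [lift_apply]
  simp [E, ite_and]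

lemma hom_apply {k : Type} [CommRing k] {n : ℕ} {A : Rep k Q} (φ : F k n ⟶ A) (f : Fin n → Q → k) :
    φ.hom f = ∑ i, ∑ g, f i g • A.ρ g (φ.hom (E i 1)) := by
  conv_lhs => rw [eq_sum f]
  have : ∀ (i : Fin n) (g : Q), A.ρ g (φ.hom (E i 1)) = φ.hom (E i g) := fun i g => by
    rw [← Rep.hom_comm_apply]
    congr 1
    change rho k n g (E i 1) = _
    rw [rho_E, mul_one]
  simp only [this]
  erw [map_sum]
  refine Finset.sum_congr rfl fun i _ => ?_
  erw [map_sum]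
  refine Finset.sum_congr rfl fun g _ => ?_
  erw [map_smul]

lemma hom_ext' {k : Type} [CommRing k] {n : ℕ} {A : Rep k Q} {φ ψ : F k n ⟶ A}
    (h : ∀ i, φ.hom (E i 1) = ψ.hom (E i 1)) : φ = ψ := by
  apply Rep.hom_ext
  apply DFunLike.ext
  intro f
  rw [hom_apply φ, hom_apply ψ]
  simp only [h]

instance (k : Type) [CommRing k] (n : ℕ) : Projective (F k n) where
  factors {X Y} f e he := by
    have hs := (Rep.epi_iff_surjective e).1 he
    choose s hs using hs
    refine ⟨lift fun i => s (f.hom (E i 1)), hom_ext' fun i => ?_⟩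
    rw [Rep.hom_comp, Representation.IntertwiningMap.comp_apply, lift_E, hs]

lemma exact_of {k : Type} [CommRing k] (S : ShortComplex (Rep k Q))
    (h : ∀ x, S.g.hom x = 0 → ∃ y, S.f.hom y = x) : S.Exact := by
  apply (forget₂ _ (ModuleCat k)).reflects_exact_of_faithful
  rw [ShortComplex.moduleCat_exact_iff]
  exact h

lemma epi_of {k : Type} [CommRing k] {A B : Rep k Q} (f : A ⟶ B)
    (h : ∀ x, ∃ y, f.hom y = x) : Epi f := (Rep.epi_iff_surjective f).2 h

lemma ext_of {k : Type} [CommRing k] {A B : Rep k Q} {f g : A ⟶ B}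
    (h : ∀ x, f.hom x = g.hom x) : f = g := by
  apply Rep.hom_ext
  apply DFunLike.ext
  exact h

/-- Morphism from an equivariant linear map. -/
def mkHom {m n : ℕ} (D : (Fin m → Q → ℤ) →ₗ[ℤ] (Fin n → Q → ℤ))
    (hD : ∀ g f, D (rho ℤ m g f) = rho ℤ n g (D f)) : F ℤ m ⟶ F ℤ n :=
  Rep.ofHom (LinearMap.intertwiningMap_of_isIntertwiningMap (rho ℤ m) (rho ℤ n) D hD)

lemma mkHom_apply {m n : ℕ} (D : (Fin m → Q → ℤ) →ₗ[ℤ] (Fin n → Q → ℤ)) (hD) (f) :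
    (mkHom D hD).hom f = D f := rfl

/-- Ranks of the resolution. -/
def r : ℕ → ℕ
  | 0 => 1
  | 1 => 2
  | 2 => 2
  | 3 => 1
  | n + 4 => r n

lemma hD1 (g f) : D1 (rho ℤ 2 g f) = rho ℤ 1 g (D1 f) := by
  ext i h
  fin_cases i
  simp [D1, rho_apply, mul_assoc]

lemma hD2 (g f) : D2 (rho ℤ 2 g f) = rho ℤ 2 g (D2 f) := by
  ext i h
  fin_cases i <;> simp [D2, rho_apply, mul_assoc]

lemma hD3 (g f) : D3 (rho ℤ 1 g f) = rho ℤ 2 g (D3 f) := by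
  ext i h
  fin_cases i <;> simp [D3, rho_apply, mul_assoc]

lemma hD4 (g f) : D4 (rho ℤ 1 g f) = rho ℤ 1 g (D4 f) := by
  ext i h
  fin_cases i
  simp only [D4, LinearMap.coe_mk, AddHom.coe_mk, rho_apply, ← sumQ (fun h => f 0 (g⁻¹ * h)),
    ← sumQ (fun h => f 0 h)]
  exact Fintype.sum_equiv (Equiv.mulLeft g⁻¹) _ _ fun h => rfl

/-- The differentials. -/
def dd : (n : ℕ) → (F ℤ (r (n + 1)) ⟶ F ℤ (r n))
  | 0 => mkHom D1 hD1
  | 1 => mkHom D2 hD2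
  | 2 => mkHom D3 hD3
  | 3 => mkHom D4 hD4
  | n + 4 => dd n

lemma dd_dd : ∀ n : ℕ, dd (n + 1) ≫ dd n = 0
  | 0 => by refine ext_of fun f => ?_; exact D1_D2 f
  | 1 => by refine ext_of fun f => ?_; exact D2_D3 f
  | 2 => by refine ext_of fun f => ?_; exact D3_D4 f
  | 3 => by refine ext_of fun f => ?_; exact D4_D1 f
  | n + 4 => dd_dd n

lemma dd_exact : ∀ (n : ℕ) (f : F ℤ (r (n + 1))), (dd n).hom f = 0 → ∃ e, (dd (n + 1)).hom e = f
  | 0 => exact1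
  | 1 => exact2
  | 2 => exact3
  | 3 => exact4
  | n + 4 => dd_exact n

/-- The periodic resolution. -/
noncomputable def P : ChainComplex (Rep ℤ Q) ℕ := ChainComplex.of (fun n => F ℤ (r n)) dd dd_dd

lemma P_d (n : ℕ) : P.d (n + 1) n = dd n := by
  simp [P]

/-- The augmentation. -/
def aug : F ℤ 1 ⟶ Rep.trivial ℤ Q ℤ := lift fun _ => 1

lemma aug_apply (f : Fin 1 → Q → ℤ) : aug.hom f =
    f 0 g0 + f 0 g1 + f 0 g2 + f 0 g3 + f 0 g4 + f 0 g5 + f 0 g6 + f 0 g7 := by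
  rw [aug]
  erw [lift_apply]
  simp [sumQ]

lemma dd_aug : dd 0 ≫ aug = 0 := by
  refine ext_of fun f => ?_
  change aug.hom (D1 f) = 0
  rw [aug_apply]
  simpa [D4] using congrFun (congrFun (D4_D1 f) 0) g0

/-- The augmentation as a map of complexes. -/
noncomputable def π : P ⟶ (ChainComplex.single₀ (Rep ℤ Q)).obj (Rep.trivial ℤ Q ℤ) :=
  (P.toSingle₀Equiv _).symm ⟨aug, by rw [P_d]; exact dd_aug⟩

lemma aug_surj (x : ℤ) : ∃ f : Fin 1 → Q → ℤ, aug.hom f = x := by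
  refine ⟨fun _ => mk x 0 0 0 0 0 0 0, ?_⟩
  rw [aug_apply]
  simp [mk_apply]

lemma aug_exact (f : Fin 1 → Q → ℤ) (hf : aug.hom f = 0) :
    ∃ e : Fin 2 → Q → ℤ, (P.d 1 0).hom e = f := by
  rw [aug_apply] at hf
  obtain ⟨e, he⟩ := exact0 f hf
  exact ⟨e, by rw [P_d]; exact he⟩

lemma quasiIso_π : QuasiIso π where
  quasiIsoAt m := by
    induction m with
    | zero =>
      rw [ChainComplex.quasiIsoAt₀_iff, ShortComplex.quasiIso_iff_of_zeros' _ rfl rfl rfl]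
      constructor
      · apply exact_of
        intro f hf
        exact aug_exact f hf
      · apply epi_of
        intro x
        exact aug_surj x
    | succ m _ =>
      rw [quasiIsoAt_iff_exactAt' (hL := ChainComplex.exactAt_succ_single_obj ..),
          HomologicalComplex.exactAt_iff' _ (m + 2) (m + 1) m (by simp) (by simp)]
      apply exact_of
      intro f hf
      obtain ⟨e, he⟩ := dd_exact m f (by rw [← P_d]; exact hf)
      refine ⟨e, ?_⟩
      rw [← P_d] at he
      exact he

/-- The periodic projective resolution of `ℤ`. -/
noncomputable def res : ProjectiveResolution (Rep.trivial ℤ Q ℤ) where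
  complex := P
  projective n := inferInstanceAs (Projective (F ℤ (r n)))
  π := π
  quasiIso := quasiIso_π

/-- The coefficients. -/
abbrev A : Rep ℤ Q := Rep.trivial ℤ Q (Additive ℂˣ)

lemma triv_apply {n : ℕ} (φ : F ℤ n ⟶ A) (f : Fin n → Q → ℤ) :
    φ.hom f = ∑ i, (∑ g, f i g) • (φ.hom (E i 1) : Additive ℂˣ) := by
  rw [hom_apply]
  refine Finset.sum_congr rfl fun i _ => ?_
  exact (Finset.sum_smul (R := ℤ) (M := Additive ℂˣ)).symm

lemma D3_triv (φ : F ℤ 2 ⟶ A) : dd 2 ≫ φ = 0 := by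
  refine ext_of fun f => ?_
  change φ.hom (D3 f) = 0
  rw [triv_apply]
  have h0 : ∑ g, D3 f 0 g = 0 := by
    rw [sumQ]
    simp [D3, mul_g3]
  have h1 : ∑ g, D3 f 1 g = 0 := by
    rw [sumQ]
    simp [D3, mul_g5] <;> ring
  simp [Fin.sum_univ_two, h0, h1]

/-- The generator. -/
def E0 : Fin 1 → Q → ℤ := E 0 1

/-- Map out of the regular representation to the coefficients. -/
noncomputable def lf (m : Additive ℂˣ) : F ℤ 1 ⟶ A := lift (A := A) fun _ => m

lemma lf_E (m : Additive ℂˣ) : (lf m).hom E0 = m := lift_E (A := A) (fun _ => m) 0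

lemma D4_triv (φ : F ℤ 1 ⟶ A) :
    (dd 3 ≫ φ = 0) ↔ (8 : ℕ) • (φ.hom E0 : Additive ℂˣ) = 0 := by
  have key : (dd 3 ≫ φ).hom E0 = (8 : ℕ) • (φ.hom E0 : Additive ℂˣ) := by
    change φ.hom (D4 E0) = _
    rw [triv_apply]
    have h0 : ∑ g, D4 E0 0 g = 8 := by
      rw [sumQ]
      decide
    rw [Fin.sum_univ_one, h0]
    exact natCast_zsmul _ 8
  rw [← key]
  constructor
  · intro h
    rw [h]
    rfl
  · intro h
    refine hom_ext' (n := 1) fun i => ?_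
    fin_cases i
    exact h

/-- The cochain complex. -/
noncomputable abbrev K : CochainComplex (ModuleCat ℤ) ℕ := P.linearYonedaObj ℤ A

lemma K_d (n : ℕ) (φ : F ℤ (r n) ⟶ A) : (K.d n (n + 1)).hom φ = dd n ≫ φ := by
  rw [← P_d]
  rfl

lemma K_d2 : K.d 2 3 = 0 := by
  apply ModuleCat.hom_ext
  apply LinearMap.ext
  intro φ
  exact (K_d 2 φ).trans (D3_triv φ)

/-- The kernel of the last differential as 8-torsion. -/
noncomputable def kerEquiv : LinearMap.ker (K.d 3 4).hom ≃+ Additive (rootsOfUnity 8 ℂ) where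
  toFun φ := Additive.ofMul ⟨Additive.toMul ((φ.1 : F ℤ 1 ⟶ A).hom E0 : Additive ℂˣ),
    ((D4_triv (φ.1 : F ℤ 1 ⟶ A)).1 ((K_d 3 _).symm.trans φ.2))⟩
  invFun z := ⟨lf (Additive.ofMul (z.toMul : ℂˣ)), (K_d 3 _).trans
    ((D4_triv _).2 (by rw [lf_E]; exact z.toMul.2))⟩
  left_inv φ := by
    apply Subtype.ext
    refine hom_ext' (n := 1) fun i => ?_
    fin_cases i
    exact lf_E _
  right_inv z := by
    apply Additive.toMul.injective
    apply Subtype.ext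
    exact lf_E (Additive.ofMul (z.toMul : ℂˣ))
  map_add' φ ψ := rfl

lemma rootsEquiv : Nonempty (Additive (rootsOfUnity 8 ℂ) ≃+ ZMod 8) := by
  have h : Nat.card (Additive (rootsOfUnity 8 ℂ)) = 8 := Complex.card_rootsOfUnity 8
  have e := zmodAddCyclicAddEquiv (G := Additive (rootsOfUnity 8 ℂ)) inferInstance
  rw [h] at e
  exact ⟨e.symm⟩

lemma main : Nonempty (groupCohomology A 3 ≃+ ZMod 8) := by
  obtain ⟨e⟩ := rootsEquiv
  have i1 : groupCohomology A 3 ≅ K.homology 3 := groupCohomologyIso A 3 res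
  have i2 : K.cycles 3 ≅ K.homology 3 := K.isoHomologyπ 2 3 (by simp) K_d2
  have i3 : K.cycles 3 ≅ (K.sc' 2 3 4).cycles :=
    ShortComplex.cyclesMapIso (K.isoSc' 2 3 4 (by simp) (by simp))
  have i4 : (K.sc' 2 3 4).cycles ≅ ModuleCat.of ℤ (LinearMap.ker (K.d 3 4).hom) :=
    (K.sc' 2 3 4).moduleCatCyclesIso
  have i := i1 ≪≫ i2.symm ≪≫ i3 ≪≫ i4
  exact ⟨(i.toLinearEquiv.toAddEquiv.trans kerEquiv).trans e⟩

end Q8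

/-- `H³(Q₈, ℂˣ) ≅ ℤ/8ℤ` as abelian groups, where `Q₈` is the
quaternion group of order 8 (`QuaternionGroup 2` in Mathlib) and `ℂˣ` carries the
trivial action (encoded as the trivial representation on `Additive ℂˣ`). -/
theorem statement17 :
    Nonempty
      ((groupCohomology (Rep.trivial ℤ (QuaternionGroup 2) (Additive ℂˣ)) 3) ≃+
        ZMod 8) := by
  exact Q8.main
end

section
/- The third group cohomology of the dihedral group D₈ of order 8 with coefficients in ℂˣ (with trivial action) satisfies H³(D₈, ℂˣ) ≅ ℤ/4ℤ × ℤ/2ℤ × ℤ/2ℤ as abelian groups. -/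
namespace D8

open CategoryTheory

/-- The integral group ring of the dihedral group of order 8. -/
abbrev R := MonoidAlgebra ℤ (DihedralGroup 4)

open DihedralGroup

/-- basis elements -/
noncomputable def B (g : DihedralGroup 4) : R := MonoidAlgebra.single g 1

lemma B_mul (g h : DihedralGroup 4) : B g * B h = B (g * h) := by
  simp [B, MonoidAlgebra.single_mul_single]

lemma B_one : B (r 0) = 1 := rfl

/-- linear extension -/
noncomputable def ext (v : DihedralGroup 4 → R) : R →ₗ[ℤ] R :=
  (Finsupp.linearCombination ℤ v) ∘ₗ (MonoidAlgebra.coeffLinearEquiv ℤ).toLinearMap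

lemma ext_B (v : DihedralGroup 4 → R) (g) : ext v (B g) = v g := by
  simp [ext, B]

lemma hom_ext {M : Type*} [AddCommGroup M] [Module ℤ M] {f g : R →ₗ[ℤ] M} (h : ∀ x, f (B x) = g (B x)) : f = g := by
  apply MonoidAlgebra.lhom_ext'
  intro a
  ext
  exact h a

lemma ind8 {P : DihedralGroup 4 → Prop} (h0 : P (r 0)) (h1 : P (r 1)) (h2 : P (r 2)) (h3 : P (r 3))
    (k0 : P (sr 0)) (k1 : P (sr 1)) (k2 : P (sr 2)) (k3 : P (sr 3)) (g) : P g := by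
  rcases g with i | i
  · fin_cases i
    exacts [h0, h1, h2, h3]
  · fin_cases i
    exacts [k0, k1, k2, k3]

noncomputable def c : ℕ → R
  | 0 => B (r 1) - B (r 0)
  | 1 => B (r 0) + B (r 1) + B (r 2) + B (r 3)
  | q + 2 => c q

noncomputable def κ : ℕ → R
  | 0 => B (sr 0)
  | 1 => B (sr 3)
  | q + 2 => - κ q

noncomputable def v0 : DihedralGroup 4 → R
  | r i => (![0, B (r 0), B (r 0) + B (r 1), B (r 0) + B (r 1) + B (r 2)] : Fin 4 → R) i
  | sr i => (![0, - (B (sr 3) + B (sr 2) + B (sr 1)), - (B (sr 3) + B (sr 2)), - B (sr 3)] : Fin 4 → R) i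

noncomputable def v1 : DihedralGroup 4 → R
  | r i => (![0, 0, 0, B (r 0)] : Fin 4 → R) i
  | sr i => (![B (sr 0), 0, 0, 0] : Fin 4 → R) i

noncomputable def E : ℕ → R →ₗ[ℤ] R
  | 0 => ext v0
  | 1 => ext v1
  | q + 2 => E q

noncomputable def vp : DihedralGroup 4 → R
  | r _ => B (r 0)
  | sr _ => B (sr 0)

noncomputable def vt : DihedralGroup 4 → R
  | r _ => 0
  | sr _ => B (r 0)

lemma vpr : vp 1 = B 1 ∧ (∀ i, vp (r i) = B 1) ∧ ∀ i, vp (sr i) = B (sr 0) :=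
  ⟨rfl, fun _ => rfl, fun _ => rfl⟩

lemma vtr : vt 1 = 0 ∧ (∀ i, vt (r i) = 0) ∧ ∀ i, vt (sr i) = B 1 :=
  ⟨rfl, fun _ => rfl, fun _ => rfl⟩

noncomputable def pr : R →ₗ[ℤ] R := ext vp

noncomputable def T : R →ₗ[ℤ] R := ext vt

noncomputable def aug : R →ₗ[ℤ] ℤ := (Finsupp.linearCombination ℤ (fun _ => (1 : ℤ))) ∘ₗ (MonoidAlgebra.coeffLinearEquiv ℤ).toLinearMap

lemma aug_B (g) : aug (B g) = 1 := by simp [aug, B]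

lemma tab : (1 + 1 : ZMod 4) = 2 ∧ (1 + 2 : ZMod 4) = 3 ∧ (1 + 3 : ZMod 4) = 0 ∧ (2 + 1 : ZMod 4) = 3
  ∧ (2 + 2 : ZMod 4) = 0 ∧ (2 + 3 : ZMod 4) = 1 ∧ (3 + 1 : ZMod 4) = 0 ∧ (3 + 2 : ZMod 4) = 1
  ∧ (3 + 3 : ZMod 4) = 2 ∧ (1 - 2 : ZMod 4) = 3 ∧ (1 - 3 : ZMod 4) = 2 ∧ (2 - 1 : ZMod 4) = 1
  ∧ (2 - 3 : ZMod 4) = 3 ∧ (3 - 1 : ZMod 4) = 2 ∧ (3 - 2 : ZMod 4) = 1 ∧ (- 1 : ZMod 4) = 3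
  ∧ (- 2 : ZMod 4) = 2 ∧ (- 3 : ZMod 4) = 1 := by decide

lemma v0r : v0 1 = 0 ∧ v0 (r 1) = B (r 0) ∧ v0 (r 2) = B (r 0) + B (r 1) ∧
    v0 (r 3) = B (r 0) + B (r 1) + B (r 2) ∧ v0 (sr 0) = 0 ∧
    v0 (sr 1) = - (B (sr 3) + B (sr 2) + B (sr 1)) ∧ v0 (sr 2) = - (B (sr 3) + B (sr 2)) ∧
    v0 (sr 3) = - B (sr 3) := ⟨rfl, rfl, rfl, rfl, rfl, rfl, rfl, rfl⟩

lemma v1r : v1 1 = 0 ∧ v1 (r 1) = 0 ∧ v1 (r 2) = 0 ∧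
    v1 (r 3) = B (r 0) ∧ v1 (sr 0) = B (sr 0) ∧
    v1 (sr 1) = 0 ∧ v1 (sr 2) = 0 ∧ v1 (sr 3) = 0 := ⟨rfl, rfl, rfl, rfl, rfl, rfl, rfl, rfl⟩

lemma c_c : ∀ q, c (q + 1) * c q = 0
  | 0 => by simp [c, mul_sub, add_mul, B_mul, tab]; try abel
  | 1 => by simp [c, mul_add, sub_mul, B_mul, tab]; try abel
  | q + 2 => by simpa [c] using c_c q

lemma κ_κ : ∀ q, κ q * κ q = 1
  | 0 => by simp [κ, B_mul, ← B_one]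
  | 1 => by simp [κ, B_mul, ← B_one]
  | q + 2 => by simpa [κ] using κ_κ q

lemma κ_c : ∀ q, κ (q + 1) * c q + c q * κ q = 0
  | 0 => by simp [κ, c, mul_sub, sub_mul, mul_add, add_mul, B_mul, tab]
  | 1 => by simp [κ, c, mul_sub, sub_mul, mul_add, add_mul, B_mul, tab]; abel
  | q + 2 => by
      have := κ_c q
      simp only [κ, c, neg_mul, mul_neg] at this ⊢
      rw [← neg_add, this, neg_zero]

lemma E_κ : ∀ q (x : R), E q x * κ (q + 1) + E q (x * κ q) = 0
  | 0, x => by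
      have : LinearMap.mulRight ℤ (κ 1) ∘ₗ E 0 + E 0 ∘ₗ LinearMap.mulRight ℤ (κ 0) = 0 := by
        apply hom_ext
        apply ind8 <;>
        simp [κ, E, ext_B, B_mul, tab, v0r, mul_add, add_mul] <;> abel
      exact LinearMap.congr_fun this x
  | 1, x => by
      have : LinearMap.mulRight ℤ (κ 2) ∘ₗ E 1 + E 1 ∘ₗ LinearMap.mulRight ℤ (κ 1) = 0 := by
        apply hom_ext
        apply ind8 <;>
        simp [κ, E, ext_B, B_mul, tab, v1r]
      exact LinearMap.congr_fun this x
  | q + 2, x => by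
      have := E_κ q x
      simp only [κ, E, mul_neg, map_neg] at this ⊢
      rw [← neg_add, this, neg_zero]

lemma E_c_zero (x : R) : E 0 x * c 0 + pr x = x := by
  have : LinearMap.mulRight ℤ (c 0) ∘ₗ E 0 + pr = LinearMap.id := by
    apply hom_ext
    apply ind8 <;>
    simp [c, E, pr, ext_B, vpr, vtr, B_mul, tab, v0r, mul_sub, add_mul] <;> try abel
  exact LinearMap.congr_fun this x

lemma E_c : ∀ q (x : R), E (q + 1) x * c (q + 1) + E q (x * c q) = x
  | 0, x => by
      have : LinearMap.mulRight ℤ (c 1) ∘ₗ E 1 + E 0 ∘ₗ LinearMap.mulRight ℤ (c 0) = LinearMap.id := by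
        apply hom_ext
        apply ind8 <;>
        simp [c, E, ext_B, vpr, vtr, B_mul, tab, v0r, v1r, mul_add, mul_sub] <;> try abel
      exact LinearMap.congr_fun this x
  | 1, x => by
      have : LinearMap.mulRight ℤ (c 2) ∘ₗ E 2 + E 1 ∘ₗ LinearMap.mulRight ℤ (c 1) = LinearMap.id := by
        apply hom_ext
        apply ind8 <;>
        simp [c, E, ext_B, vpr, vtr, B_mul, tab, v0r, v1r, mul_add, mul_sub, add_mul] <;> try abel
      exact LinearMap.congr_fun this x
  | q + 2, x => E_c q x

lemma pr_c (x : R) : pr (x * c 0) = 0 := by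
  have : pr ∘ₗ LinearMap.mulRight ℤ (c 0) = 0 := by
    apply hom_ext
    apply ind8 <;>
    simp [c, pr, ext_B, vpr, vtr, B_mul, mul_sub] <;> try abel
  exact LinearMap.congr_fun this x

lemma T_c (x : R) : T (x * c 0) = 0 := by
  have : T ∘ₗ LinearMap.mulRight ℤ (c 0) = 0 := by
    apply hom_ext
    apply ind8 <;>
    simp [c, T, ext_B, vpr, vtr, B_mul, mul_sub] <;> try abel
  exact LinearMap.congr_fun this x

lemma T_κ (x : R) : T x * κ 0 + T (x * κ 0) = pr x := by
  have : LinearMap.mulRight ℤ (κ 0) ∘ₗ T + T ∘ₗ LinearMap.mulRight ℤ (κ 0) = pr := by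
    apply hom_ext
    apply ind8 <;>
    simp [κ, pr, T, ext_B, vpr, vtr, B_mul] <;> try abel
  exact LinearMap.congr_fun this x

lemma T_zero (x : R) : T x * (κ 0 - B 1) + aug x • B 1 = pr x := by
  have : LinearMap.mulRight ℤ (κ 0 - B 1) ∘ₗ T + LinearMap.toSpanSingleton ℤ R (B 1) ∘ₗ aug = pr := by
    apply hom_ext
    apply ind8 <;>
    simp [κ, pr, T, ext_B, vpr, vtr, B_mul, aug_B, mul_sub] <;> try abel
  exact LinearMap.congr_fun this x

noncomputable def w (p q : ℕ) : R := κ q - ((-1) ^ (p + q) : ℤ) • (1 : R)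

lemma w_succ (p q : ℕ) (e : ℤ) (he : (-1) ^ (p + q) = e) :
    w p q = κ q - e • (1 : R) ∧ w (p + 1) q = κ q + e • (1 : R) ∧
    w p (q + 1) = κ (q + 1) + e • (1 : R) := by
  have h1 : ((-1) ^ (p + 1 + q) : ℤ) = - e := by rw [← he]; ring
  have h2 : ((-1) ^ (p + (q + 1)) : ℤ) = - e := by rw [← he]; ring
  simp only [w, he, h1, h2, neg_smul, sub_neg_eq_add, and_self]

lemma w_w (p q) : w (p + 1) q * w p q = 0 := by
  obtain ⟨e, he⟩ : ∃ e : ℤ, (-1) ^ (p + q) = e := ⟨_, rfl⟩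
  have h2 : e * e = 1 := by rw [← he, ← pow_add, Even.neg_one_pow ⟨_, rfl⟩]
  obtain ⟨h, h', -⟩ := w_succ p q e he
  rw [h, h']
  simp only [add_mul, mul_sub, κ_κ, smul_mul_assoc, one_mul, mul_smul_comm, mul_one]
  have h3 : (e : R) * e = 1 := by rw [← Int.cast_mul, h2, Int.cast_one]
  simp [mul_add, h3]; abel

lemma w_c (p q) : w p (q + 1) * c q + c q * w p q = 0 := by
  obtain ⟨e, he⟩ : ∃ e : ℤ, (-1) ^ (p + q) = e := ⟨_, rfl⟩
  obtain ⟨h, -, h'⟩ := w_succ p q e he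
  rw [← κ_c q, h, h']
  simp only [add_mul, mul_sub, smul_mul_assoc, one_mul, mul_smul_comm, mul_one]
  abel

lemma E_w (p q x) : E q x * w p (q + 1) + E q (x * w p q) = 0 := by
  obtain ⟨e, he⟩ : ∃ e : ℤ, (-1) ^ (p + q) = e := ⟨_, rfl⟩
  obtain ⟨h, -, h'⟩ := w_succ p q e he
  rw [← E_κ q x, h, h']
  simp only [mul_add, mul_sub, mul_smul_comm, mul_one, map_sub, map_smul]
  abel

lemma T_w_zero (x : R) : T x * w 0 0 + aug x • (1 : R) = pr x := by
  rw [← T_zero]; simp [w, ← B_one]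

lemma T_w (p) (x : R) : T x * w (p + 1) 0 + T (x * w p 0) = pr x := by
  obtain ⟨e, he⟩ : ∃ e : ℤ, (-1) ^ (p + 0) = e := ⟨_, rfl⟩
  obtain ⟨h, h', -⟩ := w_succ p 0 e he
  rw [← T_κ x, h, h']
  simp only [mul_add, mul_sub, mul_smul_comm, mul_one, map_sub, map_smul]
  abel

end D8

namespace D8

open CategoryTheory

local instance repModule (A : Rep.{0} ℤ (DihedralGroup 4)) : Module ℤ A.V := A.hV2

/-- index set -/
def I (n : ℕ) : Type := {x : ℕ × ℕ // x.1 + x.2 = n}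

def mk {n : ℕ} (p q : ℕ) (h : p + q = n) : I n := ⟨(p, q), h⟩

instance (n : ℕ) : DecidableEq (I n) := inferInstanceAs (DecidableEq {x : ℕ × ℕ // x.1 + x.2 = n})

instance (n : ℕ) : Fintype (I n) := Fintype.subtype (Finset.HasAntidiagonal.antidiagonal n) (by simp)

abbrev G := DihedralGroup 4

noncomputable def rho (n : ℕ) : Representation ℤ G (I n → R) where
  toFun g := LinearMap.pi fun i => LinearMap.mulLeft ℤ (B g) ∘ₗ LinearMap.proj i
  map_one' := by
    refine LinearMap.ext fun x => funext fun i => ?_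
    change B 1 * x i = x i
    rw [show B 1 = 1 from rfl, one_mul]
  map_mul' g h := by
    refine LinearMap.ext fun x => funext fun i => ?_
    change B (g * h) * x i = B g * (B h * x i)
    rw [← mul_assoc, B_mul]

lemma rho_apply {n} (g) (x : I n → R) (i) : rho n g x i = B g * x i := rfl

noncomputable abbrev F (n : ℕ) : Rep ℤ G := Rep.of (rho n)

/-- standard generator -/
noncomputable def e {n : ℕ} (i : I n) : F n := (Pi.single i 1 : I n → R)

variable (A : Rep.{0} ℤ G)

section
variable {k H V : Type*} [CommRing k] [Group H] [AddCommGroup V] [Module k V]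
  (ρ : Representation k H V)

noncomputable def act (v : V) : MonoidAlgebra k H →ₗ[k] V :=
  LinearMap.applyₗ v ∘ₗ ρ.asAlgebraHom.toLinearMap

lemma act_single (v : V) (g : H) : act ρ v (MonoidAlgebra.single g 1) = ρ g v := by
  simp [act, Representation.asAlgebraHom_single]

lemma act_one (v : V) : act ρ v 1 = v := by
  simp [act]

lemma act_mul (v : V) (g : H) (y) :
    act ρ v (MonoidAlgebra.single g 1 * y) = ρ g (act ρ v y) := by
  simp [act, Representation.asAlgebraHom_single]

end

lemma act_B (v : A) (g : G) : act A.ρ v (B g) = A.ρ g v := act_single _ _ _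

lemma act_B_mul (v : A) (g : G) (y : R) : act A.ρ v (B g * y) = A.ρ g (act A.ρ v y) := act_mul _ _ _ _

noncomputable def lift {n : ℕ} (a : I n → A) : F n ⟶ A := Rep.ofHom
  (LinearMap.intertwiningMap_of_isIntertwiningMap (ρ := rho n) (σ := A.ρ)
    (∑ i, act A.ρ (a i) ∘ₗ LinearMap.proj i) (by
      intro g v
      simp [rho_apply, act_B_mul]))

lemma lift_apply {n : ℕ} (a : I n → A) (x : I n → R) :
    (lift A a).hom x = ∑ i, act A.ρ (a i) (x i) := by
  change (∑ i, act A.ρ (a i) ∘ₗ LinearMap.proj i) x = _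
  simp

lemma lift_e {n : ℕ} (a : I n → A) (i) : (lift A a).hom (e i) = a i := by
  rw [e, lift_apply, Finset.sum_eq_single i]
  · simp [act_one]
  · intro j _ h
    simp [h]
  · simp

lemma hom_smul {n : ℕ} {A : Rep.{0} ℤ G} (f : F n ⟶ A) (y : R) (x : I n → R) :
    f.hom (fun i => y * x i) = act A.ρ (f.hom x) y := by
  have : f.hom.toLinearMap ∘ₗ LinearMap.pi (fun i => LinearMap.mulRight ℤ (x i)) =
      act A.ρ (f.hom x) := by
    apply hom_ext
    intro g
    have := Rep.hom_comm_apply f g x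
    rw [act_B, ← this]
    rfl
  exact LinearMap.congr_fun this y

lemma hom_eq {n : ℕ} {A : Rep.{0} ℤ G} (f : F n ⟶ A) : f = lift A (fun i => f.hom (e i)) := by
  refine Rep.hom_ext (Representation.IntertwiningMap.ext (LinearMap.ext fun x => ?_))
  change f.hom x = (lift A _).hom x
  rw [lift_apply]
  have : x = ∑ i : I n, ((fun j => x i * (e i : I n → R) j) : I n → R) := by
    funext j
    rw [Finset.sum_apply, Finset.sum_eq_single j]
    · simp [e]
    · intro i _ h
      simp [e, h.symm]
    · simp
  conv_lhs => rw [this]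
  rw [map_sum]
  exact Finset.sum_congr rfl fun i _ => hom_smul f (x i) (e i)

lemma F_ext {n : ℕ} {A : Rep.{0} ℤ G} {f f' : F n ⟶ A} (h : ∀ i, f.hom (e i) = f'.hom (e i)) : f = f' := by
  rw [hom_eq f, hom_eq f']
  simp only [h]

instance (n : ℕ) : Projective (F n) where
  factors {E X} f p hp := by
    rw [Rep.epi_iff_surjective] at hp
    choose s hs using hp
    refine ⟨lift E (fun i => s (f.hom (e i))), F_ext fun i => ?_⟩
    rw [Rep.hom_comp]
    change p.hom ((lift E _).hom (e i)) = _
    rw [lift_e]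
    exact hs _

noncomputable def d (n : ℕ) : F (n + 1) ⟶ F n := Rep.ofHom
  (LinearMap.intertwiningMap_of_isIntertwiningMap (ρ := rho (n + 1)) (σ := rho n)
    (LinearMap.pi fun i =>
      LinearMap.mulRight ℤ (c i.1.2) ∘ₗ LinearMap.proj (mk i.1.1 (i.1.2 + 1) (by have := i.2; omega))
      + LinearMap.mulRight ℤ (w i.1.1 i.1.2) ∘ₗ
        LinearMap.proj (mk (i.1.1 + 1) i.1.2 (by have := i.2; omega))) (by
      intro g v
      funext i
      simp [rho_apply, mul_add, mul_assoc]))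

lemma d_apply (n : ℕ) (x : I (n + 1) → R) (p q : ℕ) (h : p + q = n) :
    (d n).hom x (mk p q h) = x (mk p (q + 1) (by omega)) * c q + x (mk (p + 1) q (by omega)) * w p q :=
  rfl

lemma d_d (n : ℕ) : d (n + 1) ≫ d n = 0 := by
  refine Rep.hom_ext (Representation.IntertwiningMap.ext (LinearMap.ext fun x => ?_))
  change (d n).hom ((d (n + 1)).hom x) = (0 : I n → R)
  funext ⟨⟨p, q⟩, h⟩
  change (d n).hom _ (mk p q h) = 0
  rw [d_apply, d_apply, d_apply]
  simp only [add_mul, mul_assoc]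
  rw [c_c, w_w, mul_zero, mul_zero, zero_add, add_zero, ← mul_add, w_c, mul_zero]

noncomputable def h {n : ℕ} (x : I n → R) : I (n + 1) → R
  | ⟨(0, 0), _⟩ => 0
  | ⟨(p + 1, 0), hh⟩ => T (x (mk p 0 (by simp at hh ⊢; omega)))
  | ⟨(p, q + 1), hh⟩ => E q (x (mk p q (by simp at hh ⊢; omega)))

lemma h_zero {n} (x : I n → R) (p) (hh) : h x (mk (p + 1) 0 hh) = T (x (mk p 0 (by omega))) := rfl

lemma h_succ {n} (x : I n → R) (p q) (hh) : h x (mk p (q + 1) hh) = E q (x (mk p q (by omega))) := by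
  cases p <;> rfl

lemma exact_succ (n : ℕ) (x : I (n + 1) → R) (hx : (d n).hom x = (0 : I n → R)) :
    (d (n + 1)).hom (h x) = x := by
  have hx' : ∀ p q (hh : p + q = n), x (mk p (q + 1) (by omega)) * c q = - (x (mk (p + 1) q (by omega)) * w p q) := by
    intro p q hh
    have := congrFun hx (mk p q hh)
    rw [d_apply] at this
    exact eq_neg_of_add_eq_zero_left this
  funext ⟨⟨p, q⟩, hh⟩
  change (d (n + 1)).hom _ (mk p q hh) = x (mk p q hh)
  rw [d_apply]
  rcases q with _ | q
  · rcases p with _ | p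
    · simp at hh
    · rw [h_zero, h_succ]
      have h1 := E_c_zero (x (mk (p + 1) 0 hh))
      have h2 := T_w p (x (mk (p + 1) 0 hh))
      have h3 := hx' p 0 (by simp at hh; omega)
      rw [← neg_eq_iff_eq_neg] at h3
      rw [← h3, map_neg, T_c, neg_zero, add_zero] at h2
      rw [h2]; exact h1
  · rw [h_succ, h_succ]
    have h1 := E_c q (x (mk p (q + 1) hh))
    have h2 := E_w p q (x (mk (p + 1) q (by omega)))
    have h3 := hx' p q (by omega)
    rw [h3, map_neg] at h1
    rw [← eq_neg_iff_add_eq_zero] at h2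
    rw [h2]; exact h1

noncomputable def epsi : F 0 ⟶ Rep.trivial ℤ G ℤ := lift _ fun _ => (1 : ℤ)

lemma triv_act {V : Type} [AddCommGroup V] (y : R) (v : V) :
    act (Representation.trivial ℤ G V) v y = aug y • v := by
  have : act (Representation.trivial ℤ G V) v = LinearMap.toSpanSingleton ℤ V v ∘ₗ aug := by
    apply hom_ext
    intro g
    have := act_B (Rep.trivial ℤ G V) v g
    simp [aug_B]
    exact this
  exact LinearMap.congr_fun this y

lemma aug_mul (x y : R) : aug (x * y) = aug x * aug y := by
  have : aug ∘ₗ LinearMap.mulRight ℤ y = LinearMap.mulRight ℤ (aug y) ∘ₗ aug := by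
    apply hom_ext
    intro g
    have : aug ∘ₗ LinearMap.mulLeft ℤ (B g) = aug := by
      apply hom_ext
      intro h
      simp [B_mul, aug_B]
    simpa [aug_B] using LinearMap.congr_fun this y
  exact LinearMap.congr_fun this x

lemma aug_one : aug 1 = 1 := aug_B _

lemma epsi_apply (x : I 0 → R) : epsi.hom x = aug (x (mk 0 0 rfl)) := by
  rw [epsi, lift_apply, Finset.sum_eq_single (mk 0 0 rfl)]
  · have := triv_act (x (mk 0 0 rfl)) (1 : ℤ)
    simpa using this
  · rintro ⟨⟨p, q⟩, hh⟩ _ h'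
    refine absurd ?_ h'
    simp at hh
    obtain ⟨rfl, rfl⟩ := hh
    rfl
  · simp

lemma exact_zero (x : I 0 → R) (hx : epsi.hom x = (0 : ℤ)) :
    (d 0).hom (h x) = x := by
  funext ⟨⟨p, q⟩, hh⟩
  simp at hh
  obtain ⟨rfl, rfl⟩ := hh
  change (d 0).hom _ (mk 0 0 rfl) = x (mk 0 0 rfl)
  rw [d_apply, h_zero, h_succ]
  rw [epsi_apply] at hx
  have h1 := T_w_zero (x (mk 0 0 rfl))
  rw [hx, zero_smul, add_zero] at h1
  rw [h1, E_c_zero]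

lemma d_epsi : d 0 ≫ epsi = 0 := by
  refine Rep.hom_ext (Representation.IntertwiningMap.ext (LinearMap.ext fun x => ?_))
  change epsi.hom ((d 0).hom x) = (0 : ℤ)
  rw [epsi_apply, d_apply]
  simp [aug_mul, c, w, κ, aug_B, aug_one, -DihedralGroup.r_zero]

end D8

namespace D8

open CategoryTheory

noncomputable def cx : ChainComplex (Rep.{0} ℤ G) ℕ := ChainComplex.of F d d_d

lemma cx_d (n : ℕ) : cx.d (n + 1) n = d n := ChainComplex.of_d _ _ _

noncomputable def cxπ : cx ⟶ (ChainComplex.single₀ (Rep.{0} ℤ G)).obj (Rep.trivial ℤ G ℤ) :=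
  (cx.toSingle₀Equiv _).symm ⟨epsi, by rw [cx_d]; exact d_epsi⟩

lemma cxπ_zero : cxπ.f 0 = epsi :=
  ChainComplex.toSingle₀Equiv_symm_apply_f_zero _ _

lemma rep_exact {k H : Type} [CommRing k] [Group H] (S : ShortComplex (Rep.{0} k H))
    (hS : ∀ x : S.X₂, S.g.hom x = 0 → ∃ y : S.X₁, S.f.hom y = x) : S.Exact := by
  apply (forget₂ (Rep.{0} k H) (ModuleCat.{0} k)).reflects_exact_of_faithful
  rw [ShortComplex.moduleCat_exact_iff]
  intro x hx
  exact hS x hx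

lemma quasi : QuasiIso cxπ where
  quasiIsoAt m := by
    induction m with
    | zero =>
      rw [ChainComplex.quasiIsoAt₀_iff, ShortComplex.quasiIso_iff_of_zeros' _ rfl rfl rfl]
      constructor
      · apply rep_exact
        intro x hx
        change (cxπ.f 0).hom x = 0 at hx
        rw [cxπ_zero] at hx
        refine ⟨h (x : I 0 → R), ?_⟩
        change (cx.d 1 0).hom _ = _
        rw [cx_d]
        exact exact_zero x hx
      · rw [Rep.epi_iff_surjective]
        intro x
        refine ⟨(fun _ => (show ℤ from x) • (1 : R) : I 0 → R), ?_⟩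
        change (cxπ.f 0).hom _ = x
        rw [cxπ_zero]
        refine (epsi_apply _).trans ?_
        rw [map_smul, aug_one]
        exact mul_one (show ℤ from x)
    | succ m _ =>
      rw [quasiIsoAt_iff_exactAt' (hL := ChainComplex.exactAt_succ_single_obj ..),
          HomologicalComplex.exactAt_iff' _ (m + 2) (m + 1) m (by simp) (by simp)]
      apply rep_exact
      intro x hx
      change (cx.d (m + 1) m).hom x = 0 at hx
      rw [cx_d] at hx
      refine ⟨h (x : I (m + 1) → R), ?_⟩
      change (cx.d (m + 2) (m + 1)).hom _ = _
      rw [cx_d]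
      exact exact_succ m x hx

noncomputable def res : ProjectiveResolution (Rep.trivial ℤ G ℤ) where
  complex := cx
  projective n := inferInstanceAs (Projective (F n))
  π := cxπ
  quasiIso := quasi

lemma homology_equiv {k : Type} [CommRing k] (S : ShortComplex (ModuleCat.{0} k)) {M : Type} [AddCommGroup M]
    (N : AddSubgroup M) (φ : S.X₂ →+ M) (h0 : ∀ x, S.g x = 0 → φ x ∈ N)
    (h1 : ∀ m ∈ N, ∃ x, S.g x = 0 ∧ φ x = m)
    (h2 : ∀ x, S.g x = 0 → φ x = 0 → ∃ y, S.f y = x) (h3 : ∀ y, φ (S.f y) = 0) :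
    Nonempty (S.homology ≃+ N) := by
  let ψ : LinearMap.ker S.g.hom →+ N :=
    { toFun := fun x => ⟨φ x.1, h0 _ x.2⟩
      map_zero' := Subtype.ext (map_zero φ)
      map_add' := fun x y => Subtype.ext (map_add φ _ _) }
  have hs : Function.Surjective ψ := by
    intro m
    obtain ⟨x, hx, hm⟩ := h1 m.1 m.2
    exact ⟨⟨x, hx⟩, Subtype.ext hm⟩
  have hk : (LinearMap.range S.moduleCatToCycles).toAddSubgroup = ψ.ker := by
    ext ⟨x, hx⟩
    constructor
    · rintro ⟨y, hy⟩
      have : S.f y = x := congrArg Subtype.val hy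
      refine Subtype.ext ?_
      change φ x = 0
      rw [← this, h3]
    · intro hh
      obtain ⟨y, hy⟩ := h2 x hx (congrArg Subtype.val hh)
      exact ⟨y, Subtype.ext hy⟩
  exact ⟨(S.moduleCatHomologyIso.toLinearEquiv.toAddEquiv).trans
    ((QuotientAddGroup.quotientAddEquivOfEq hk).trans
      (QuotientAddGroup.quotientKerEquivOfSurjective ψ hs))⟩

variable (A : Type) [AddCommGroup A]

abbrev tr : Rep.{0} ℤ G := Rep.trivial ℤ G A

noncomputable def cc := res.complex.linearYonedaObj ℤ (tr A)

lemma cc_d (n : ℕ) (f : F n ⟶ tr A) : (cc A).d n (n + 1) f = d n ≫ f := by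
  change cx.d (n + 1) n ≫ f = _
  rw [cx_d]
  rfl


lemma sum_I2 {M : Type*} [AddCommMonoid M] (φ : I 2 → M) :
    ∑ i, φ i = φ (mk 0 2 rfl) + φ (mk 1 1 rfl) + φ (mk 2 0 rfl) := by
  rw [show (Finset.univ : Finset (I 2)) = {mk 0 2 rfl, mk 1 1 rfl, mk 2 0 rfl} by decide]
  rw [Finset.sum_insert (by decide), Finset.sum_insert (by decide), Finset.sum_singleton, add_assoc]

lemma sum_I3 {M : Type*} [AddCommMonoid M] (φ : I 3 → M) :
    ∑ i, φ i = φ (mk 0 3 rfl) + φ (mk 1 2 rfl) + φ (mk 2 1 rfl) + φ (mk 3 0 rfl) := by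
  rw [show (Finset.univ : Finset (I 3)) = {mk 0 3 rfl, mk 1 2 rfl, mk 2 1 rfl, mk 3 0 rfl} by decide]
  rw [Finset.sum_insert (by decide), Finset.sum_insert (by decide),
    Finset.sum_insert (by decide), Finset.sum_singleton, add_assoc, add_assoc]

lemma f_apply {n : ℕ} (f : F n ⟶ tr A) (x : I n → R) :
    f.hom x = ∑ i, aug (x i) • (show A from f.hom (e i)) := by
  conv_lhs => rw [hom_eq f]
  rw [lift_apply]
  exact Finset.sum_congr rfl fun i _ => triv_act _ _

lemma d_e {n : ℕ} (i : I (n + 1)) (p q : ℕ) (hh : p + q = n) : aug ((d n).hom (e i) (mk p q hh)) =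
    (if i.1 = (p, q + 1) then aug (c q) else 0) + (if i.1 = (p + 1, q) then aug (w p q) else 0) := by
  rw [d_apply, map_add, aug_mul, aug_mul]
  have key : ∀ (j : I (n + 1)), aug ((e i : I (n + 1) → R) j) = if i.1 = j.1 then 1 else 0 := by
    intro j
    by_cases h : i = j
    · subst h; simp [e, aug_one]
    · have h' : i.1 ≠ j.1 := fun h' => h (Subtype.ext h')
      rw [if_neg h']
      simp [e, Ne.symm h]
  rw [key, key]
  have hm : ∀ (P : Prop) [Decidable P] (z : ℤ), (if P then 1 else 0) * z = if P then z else 0 := by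
    intro P _ z
    split_ifs <;> simp
  exact congrArg₂ _ (hm _ _) (hm _ _)

lemma aug_c : ∀ q, aug (c q) = if q % 2 = 0 then 0 else 4
  | 0 => by simp [c, aug_B, -DihedralGroup.r_zero]
  | 1 => by simp [c, aug_B, -DihedralGroup.r_zero]
  | q + 2 => by rw [c, aug_c q]; simp

lemma aug_κ : ∀ q, aug (κ q) = if q % 4 ≤ 1 then 1 else -1
  | 0 => by simp [κ, aug_B]
  | 1 => by simp [κ, aug_B]
  | q + 2 => by
    rw [κ, map_neg, aug_κ q]
    split_ifs <;> first | rfl | omega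

lemma aug_w (p q) : aug (w p q) = (if q % 4 ≤ 1 then 1 else -1) - (-1) ^ (p + q) := by
  rw [w, map_sub, map_smul, aug_κ, aug_one]
  simp

variable {A} in
/-- value of a cochain -/
noncomputable def ev {n : ℕ} (f : F n ⟶ tr A) (p q : ℕ) (hh : p + q = n) : A := f.hom (e (mk p q hh))

lemma d2 (f : F 2 ⟶ tr A) :
    ev (d 2 ≫ f) 0 3 rfl = 0 ∧ ev (d 2 ≫ f) 2 1 rfl = 0 ∧ ev (d 2 ≫ f) 3 0 rfl = 0 ∧
    ev (d 2 ≫ f) 1 2 rfl = (4 : ℤ) • ev f 1 1 rfl + (-2 : ℤ) • ev f 0 2 rfl := by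
  refine ⟨?_, ?_, ?_, ?_⟩
  all_goals
    change f.hom ((d 2).hom (e _)) = _
    rw [f_apply, sum_I2, d_e, d_e, d_e]
    simp [mk, aug_c, aug_w, ev]
  try abel

lemma d3 (f : F 3 ⟶ tr A) :
    ev (d 3 ≫ f) 0 4 rfl = (4 : ℤ) • ev f 0 3 rfl ∧ ev (d 3 ≫ f) 1 3 rfl = 0 ∧
    ev (d 3 ≫ f) 2 2 rfl = (4 : ℤ) • ev f 2 1 rfl ∧
    ev (d 3 ≫ f) 3 1 rfl = (2 : ℤ) • ev f 2 1 rfl ∧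
    ev (d 3 ≫ f) 4 0 rfl = (2 : ℤ) • ev f 3 0 rfl := by
  refine ⟨?_, ?_, ?_, ?_, ?_⟩
  all_goals
    change f.hom ((d 3).hom (e _)) = _
    rw [f_apply, sum_I3, d_e, d_e, d_e, d_e]
    simp [mk, aug_c, aug_w, ev]

lemma final (hA : ∀ a : A, ∃ b, (2 : ℤ) • b = a) :
    Nonempty (groupCohomology (tr A) 3 ≃+
      ((AddMonoidHom.ker (zsmulAddGroupHom (4 : ℤ) : A →+ A)).prod
        ((AddMonoidHom.ker (zsmulAddGroupHom (2 : ℤ) : A →+ A)).prod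
          (AddMonoidHom.ker (zsmulAddGroupHom (2 : ℤ) : A →+ A))))) := by
  let S := (cc A).sc' 2 3 4
  let φ : S.X₂ →+ A × A × A :=
    { toFun := fun f => (ev (A := A) (n := 3) f 0 3 rfl, ev (A := A) (n := 3) f 2 1 rfl,
        ev (A := A) (n := 3) f 3 0 rfl)
      map_zero' := rfl
      map_add' := fun f g => rfl }
  have hg : ∀ f : F 3 ⟶ tr A, S.g f = d 3 ≫ f := cc_d A 3
  have hf : ∀ f : F 2 ⟶ tr A, S.f f = d 2 ≫ f := cc_d A 2
  have key := homology_equiv S ((AddMonoidHom.ker (zsmulAddGroupHom (4 : ℤ) : A →+ A)).prod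
        ((AddMonoidHom.ker (zsmulAddGroupHom (2 : ℤ) : A →+ A)).prod
          (AddMonoidHom.ker (zsmulAddGroupHom (2 : ℤ) : A →+ A)))) φ ?_ ?_ ?_ ?_
  · obtain ⟨E⟩ := key
    exact ⟨(groupCohomologyIso (tr A) 3 res ≪≫
      (cc A).homologyIsoSc' 2 3 4 (by simp) (by simp)).toLinearEquiv.toAddEquiv.trans E⟩
  · intro (f : F 3 ⟶ tr A) hfz
    have h0 : d 3 ≫ f = 0 := (hg f).symm.trans hfz
    obtain ⟨h1, -, -, h2, h3⟩ := d3 A f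
    rw [h0] at h1 h2 h3
    exact ⟨h1.symm, h2.symm, h3.symm⟩
  · rintro ⟨a, b, c'⟩ ⟨ha, hb, hc⟩
    let f : F 3 ⟶ tr A := lift (tr A) fun i =>
      if i.1.1 = 0 then a else if i.1.1 = 1 then 0 else if i.1.1 = 2 then b else c'
    have e1 : ev f 0 3 rfl = a := lift_e (tr A) _ _
    have e2 : ev f 2 1 rfl = b := lift_e (tr A) _ _
    have e3 : ev f 3 0 rfl = c' := lift_e (tr A) _ _
    have ha : (4 : ℤ) • a = 0 := ha
    have hb : (2 : ℤ) • b = 0 := hb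
    have hc : (2 : ℤ) • c' = 0 := hc
    refine ⟨f, ?_, ?_⟩
    · refine (hg f).trans (F_ext fun i => ?_)
      change _ = (0 : A)
      obtain ⟨h1, h2, h3, h4, h5⟩ := d3 A f
      rw [e1, ha] at h1
      rw [e2, show (4 : ℤ) = 2 * 2 by rfl, mul_smul, hb, smul_zero] at h3
      rw [e2, hb] at h4
      rw [e3, hc] at h5
      have : i ∈ ({mk 0 4 rfl, mk 1 3 rfl, mk 2 2 rfl, mk 3 1 rfl, mk 4 0 rfl} : Finset (I 4)) := by
        revert i; decide
      simp only [Finset.mem_insert, Finset.mem_singleton] at this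
      rcases this with rfl | rfl | rfl | rfl | rfl
      · exact h1
      · exact h2
      · exact h3
      · exact h4
      · exact h5
    · exact Prod.ext e1 (Prod.ext e2 e3)
  · intro (f : F 3 ⟶ tr A) _ hφ
    have e1 : ev f 0 3 rfl = 0 := congrArg Prod.fst hφ
    have e2 : ev f 2 1 rfl = 0 := congrArg (fun z => z.2.1) hφ
    have e3 : ev f 3 0 rfl = 0 := congrArg (fun z => z.2.2) hφ
    obtain ⟨b, hb⟩ := hA (- ev f 1 2 rfl)
    let g : F 2 ⟶ tr A := lift (tr A) fun i => if i.1.1 = 0 then b else 0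
    have g1 : ev g 0 2 rfl = b := lift_e (tr A) _ _
    have g2 : ev g 1 1 rfl = 0 := lift_e (tr A) _ _
    refine ⟨g, (hf g).trans (F_ext fun i => ?_)⟩
    obtain ⟨h1, h2, h3, h4⟩ := d2 A g
    rw [g1, g2, smul_zero, zero_add, neg_smul, hb, neg_neg] at h4
    have : i ∈ ({mk 0 3 rfl, mk 1 2 rfl, mk 2 1 rfl, mk 3 0 rfl} : Finset (I 3)) := by
      revert i; decide
    simp only [Finset.mem_insert, Finset.mem_singleton] at this
    rcases this with rfl | rfl | rfl | rfl
    · exact h1.trans e1.symm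
    · exact h4
    · exact h2.trans e2.symm
    · exact h3.trans e3.symm
  · intro (g : F 2 ⟶ tr A)
    obtain ⟨h1, h2, h3, -⟩ := d2 A g
    rw [hf g]
    exact Prod.ext h1 (Prod.ext h2 h3)

lemma torsion (n : ℕ) [NeZero n] :
    Nonempty (AddMonoidHom.ker (zsmulAddGroupHom (n : ℤ) : Additive ℂˣ →+ Additive ℂˣ) ≃+ ZMod n) := by
  have h1 := zmodCyclicMulEquiv (G := rootsOfUnity n ℂ) inferInstance
  rw [Complex.card_rootsOfUnity] at h1
  have h1' : Additive (rootsOfUnity n ℂ) ≃+ ZMod n := (MulEquiv.toAdditiveRight h1).symm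
  refine ⟨AddEquiv.trans ?_ h1'⟩
  exact
    { toFun := fun x => Additive.ofMul ⟨x.1.toMul, (zpow_natCast _ _).symm.trans x.2⟩
      invFun := fun x => ⟨Additive.ofMul x.toMul.1, (zpow_natCast x.toMul.1 n).trans x.toMul.2⟩
      left_inv := fun x => rfl
      right_inv := fun x => rfl
      map_add' := fun x y => rfl }

lemma halves (a : Additive ℂˣ) : ∃ b, (2 : ℤ) • b = a := by
  obtain ⟨z, hz⟩ := IsAlgClosed.exists_pow_nat_eq (a.toMul : ℂ) (n := 2) (by norm_num)
  have hz0 : z ≠ 0 := by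
    rintro rfl
    apply a.toMul.ne_zero
    rw [← hz]; norm_num
  exact ⟨Additive.ofMul (Units.mk0 z hz0), congrArg Additive.ofMul (Units.ext hz)⟩

end D8

/-- `H³(D₈, ℂˣ) ≅ ℤ/4ℤ × ℤ/2ℤ × ℤ/2ℤ` as abelian groups, where `D₈`
is the dihedral group of order 8 (`DihedralGroup 4` in Mathlib) and `ℂˣ` carries the
trivial action (encoded as the trivial representation on `Additive ℂˣ`). -/
theorem statement18 :
    Nonempty
      ((groupCohomology (Rep.trivial ℤ (DihedralGroup 4) (Additive ℂˣ)) 3) ≃+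
        (ZMod 4 × ZMod 2 × ZMod 2)) := by
  obtain ⟨E⟩ := D8.final (Additive ℂˣ) D8.halves
  obtain ⟨E4⟩ := D8.torsion 4
  obtain ⟨E2⟩ := D8.torsion 2
  exact ⟨E.trans ((AddSubgroup.prodEquiv _ _).trans
    (AddEquiv.prodCongr E4 ((AddSubgroup.prodEquiv _ _).trans (AddEquiv.prodCongr E2 E2))))⟩
end
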